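/- Let r be a nonnegative integer and G ⊆ ℝ^N a definable C^r group (a definable C^r submanifold of ℝ^N that is a group whose multiplication G × G → G and inversion G → G are definable C^r maps) which is closed and bounded in ℝ^N, and let H be a subgroup of G that is a definable set. Then there exist a definable C^r submanifold X of some ℝ^k with dim X = dim G − dim H and a surjective definable C^r map ι: G → X such that (a) for all g₁, g₂ ∈ G, ι(g₁) = ι(g₂) if and only if g₁⁻¹g₂ ∈ H, and (b) ι is definably identifying: every definable subset K of X such that ι⁻¹(K) is closed in G is closed in X. Moreover, if H is a normal subgroup of G, then there exist definable C^r maps mult: X × X → X and inv: X → X with mult(ι(g₁), ι(g₂)) = ι(g₁g₂) and inv(ι(g)) = ι(g⁻¹) for all g, g₁, g₂ ∈ G; in particular X is a definable C^r group isomorphic as a group to G/H. -/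

import Mathlib

open FirstOrder Set Topology

namespace Paper

variable (L : FirstOrder.Language) [L.Structure ℝ]

/-- A subset of `ℝⁿ` is definable in the structure (with parameters from `ℝ`). -/
def Def (n : ℕ) (s : Set (Fin n → ℝ)) : Prop :=
  Set.Definable (Set.univ : Set ℝ) L s

/-- A subset of `ℝ` is definable. -/
def Def1 (s : Set ℝ) : Prop := Def L 1 {x | x 0 ∈ s}

/-- The structure expands the ordered field `(ℝ, <, +, ·, 0, 1)`:
the order and the field operations (and the constants) are definable. -/
def ExpandsOrderedField : Prop :=
  Def L 2 {x | x 0 < x 1} ∧ Def L 3 {x | x 0 + x 1 = x 2} ∧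
  Def L 3 {x | x 0 * x 1 = x 2} ∧ Def L 1 {x | x 0 = 0} ∧ Def L 1 {x | x 0 = 1}

/-- Local o-minimality: every definable subset of `ℝ` is, near each point, a finite
union of points and open intervals. -/
def LocallyOMinimal : Prop :=
  ∀ X : Set ℝ, Def1 L X → ∀ a : ℝ,
    ∃ b c : ℝ, b < a ∧ a < c ∧
      ∃ (P : Finset ℝ) (J : Finset (ℝ × ℝ)),
        X ∩ Set.Ioo b c = ↑P ∪ ⋃ p ∈ J, Set.Ioo p.1 p.2

/-- First component of a point of `ℝ^(m+n) = ℝ^m × ℝ^n`. -/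
def fstFun {m n : ℕ} (z : Fin (m + n) → ℝ) : Fin m → ℝ := fun i => z (Fin.castAdd n i)

/-- Second component of a point of `ℝ^(m+n) = ℝ^m × ℝ^n`. -/
def sndFun {m n : ℕ} (z : Fin (m + n) → ℝ) : Fin n → ℝ := fun j => z (Fin.natAdd m j)

/-- The map `f : X → ℝⁿ`, `X ⊆ ℝ^m`, is definable (its graph over `X` is definable). -/
def DefMapOn (m n : ℕ) (X : Set (Fin m → ℝ)) (f : (Fin m → ℝ) → (Fin n → ℝ)) : Prop :=
  Def L (m + n) {z | fstFun z ∈ X ∧ sndFun z = f (fstFun z)}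

/-- The function `f : X → ℝ`, `X ⊆ ℝ^m`, is definable. -/
def DefFunOn (m : ℕ) (X : Set (Fin m → ℝ)) (f : (Fin m → ℝ) → ℝ) : Prop :=
  DefMapOn L m 1 X fun x _ => f x

/-- `f` is of class `C^r` on `X` in the sense that near every point of `X` it agrees on `X`
with a `C^r` map defined on an open neighborhood in the ambient space. -/
def CrMapOn (r m n : ℕ) (X : Set (Fin m → ℝ)) (f : (Fin m → ℝ) → (Fin n → ℝ)) : Prop :=
  ∀ a ∈ X, ∃ (W : Set (Fin m → ℝ)) (g : (Fin m → ℝ) → (Fin n → ℝ)),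
    a ∈ W ∧ IsOpen W ∧ ContDiffOn ℝ r g W ∧ Set.EqOn f g (X ∩ W)

/-- Real-valued version of `CrMapOn`. -/
def CrFunOn (r m : ℕ) (X : Set (Fin m → ℝ)) (f : (Fin m → ℝ) → ℝ) : Prop :=
  ∀ a ∈ X, ∃ (W : Set (Fin m → ℝ)) (g : (Fin m → ℝ) → ℝ),
    a ∈ W ∧ IsOpen W ∧ ContDiffOn ℝ r g W ∧ Set.EqOn f g (X ∩ W)

/-- A definable `C^r` map `X → ℝⁿ`. -/
def DefCrMapOn (r m n : ℕ) (X : Set (Fin m → ℝ)) (f : (Fin m → ℝ) → (Fin n → ℝ)) : Prop :=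
  DefMapOn L m n X f ∧ CrMapOn r m n X f

/-- A definable `C^r` function `X → ℝ`. -/
def DefCrFunOn (r m : ℕ) (X : Set (Fin m → ℝ)) (f : (Fin m → ℝ) → ℝ) : Prop :=
  DefFunOn L m X f ∧ CrFunOn r m X f

/-- A definable `C^r` submanifold of `ℝⁿ` of dimension `d`: around every point there is a
definable `C^r` chart of `ℝⁿ` straightening `M` to the first `d` coordinates. -/
def IsDefCrSubmanifold (r n d : ℕ) (M : Set (Fin n → ℝ)) : Prop :=
  Def L n M ∧
  ∀ a ∈ M, ∃ (U V : Set (Fin n → ℝ)) (φ ψ : (Fin n → ℝ) → (Fin n → ℝ)),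
    a ∈ U ∧ IsOpen U ∧ Def L n U ∧
    (0 : Fin n → ℝ) ∈ V ∧ IsOpen V ∧ Def L n V ∧
    DefMapOn L n n U φ ∧ DefMapOn L n n V ψ ∧
    ContDiffOn ℝ r φ U ∧ ContDiffOn ℝ r ψ V ∧
    Set.BijOn φ U V ∧ Set.InvOn ψ φ U V ∧
    φ a = 0 ∧
    φ '' (M ∩ U) = {x ∈ V | ∀ i : Fin n, d ≤ (i : ℕ) → x i = 0}

/-- The Euclidean norm on `ℝⁿ`. -/
noncomputable def eunorm {n : ℕ} (x : Fin n → ℝ) : ℝ := Real.sqrt (∑ i, x i ^ 2)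

/-- Projection of `ℝⁿ` onto the `d` coordinates selected by `σ`. -/
def coordProj {n : ℕ} (d : ℕ) (σ : Fin d → Fin n) (x : Fin n → ℝ) : Fin d → ℝ :=
  fun i => x (σ i)

/-- `X ⊆ ℝⁿ` has dimension `d`: `d` is the largest integer such that some coordinate
projection of `X` onto `ℝ^d` has nonempty interior. -/
def HasDim {n : ℕ} (X : Set (Fin n → ℝ)) (d : ℕ) : Prop :=
  (∃ σ : Fin d → Fin n, Function.Injective σ ∧ (interior (coordProj d σ '' X)).Nonempty) ∧
  ∀ (e : ℕ) (σ : Fin e → Fin n), Function.Injective σ →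
    (interior (coordProj e σ '' X)).Nonempty → e ≤ d

/-- A (bounded) open box in `ℝⁿ`. -/
def IsOpenBox {n : ℕ} (B : Set (Fin n → ℝ)) : Prop :=
  ∃ a b : Fin n → ℝ, (∀ i, a i < b i) ∧ B = Set.pi Set.univ fun i => Set.Ioo (a i) (b i)

/-- A type identified with a finite power of `ℝ`. -/
class Coord (E : Type) where
  idx : Type
  [fin : Finite idx]
  eqv : E ≃ (idx → ℝ)

attribute [instance] Coord.fin

instance : Coord ℝ := ⟨Unit, (Equiv.funUnique Unit ℝ).symm⟩

instance (n : ℕ) : Coord (Fin n → ℝ) := ⟨Fin n, Equiv.refl _⟩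

instance (E F : Type) [Coord E] [Coord F] : Coord (E × F) :=
  ⟨Coord.idx E ⊕ Coord.idx F,
    (Equiv.prodCongr Coord.eqv Coord.eqv).trans (Equiv.sumArrowEquivProdArrow _ _ _).symm⟩

/-- A definable predicate on a finite power of `ℝ`. -/
@[fun_prop]
def DP {E : Type} [Coord E] (p : E → Prop) : Prop :=
  (Set.univ : Set ℝ).Definable L {v : Coord.idx E → ℝ | p (Coord.eqv.symm v)}

/-- A definable function between finite powers of `ℝ`. -/
@[fun_prop]
def DF {E F : Type} [Coord E] [Coord F] (f : E → F) : Prop :=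
  DP L fun z : E × F => z.2 = f z.1

section Tools

variable {L}
variable {E F F' : Type} [Coord E] [Coord F] [Coord F']

theorem DP.congr {p q : E → Prop} (hp : DP L p) (h : ∀ x, q x ↔ p x) : DP L q := by
  have : q = p := funext fun x => propext (h x)
  rwa [this]

theorem DP.reindex {p : F → Prop} (hp : DP L p) (f : E → F) (ρ : Coord.idx F → Coord.idx E)
    (h : ∀ x j, Coord.eqv (f x) j = Coord.eqv x (ρ j)) : DP L fun x => p (f x) := by
  have := Set.Definable.preimage_comp ρ hp
  unfold DP
  convert this using 1
  ext v
  simp only [Set.mem_ofPred_eq, Set.mem_preimage]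
  have : f (Coord.eqv.symm v) = Coord.eqv.symm (v ∘ ρ) := by
    apply Coord.eqv.injective
    ext j
    simp [h]
  rw [this]

@[fun_prop]
theorem DP.and {p q : E → Prop} (hp : DP L p) (hq : DP L q) : DP L fun x => p x ∧ q x :=
  Set.Definable.inter hp hq

@[fun_prop]
theorem DP.or {p q : E → Prop} (hp : DP L p) (hq : DP L q) : DP L fun x => p x ∨ q x :=
  Set.Definable.union hp hq

@[fun_prop]
theorem DP.not {p : E → Prop} (hp : DP L p) : DP L fun x => ¬ p x :=
  Set.Definable.compl hp

theorem DP.imp {p q : E → Prop} (hp : DP L p) (hq : DP L q) : DP L fun x => p x → q x :=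
  (hp.not.or hq).congr fun _ => imp_iff_not_or

@[fun_prop]
theorem DP.exists {p : E → F → Prop} (hp : DP L fun z : E × F => p z.1 z.2) :
    DP L fun x => ∃ y, p x y := by
  have := Set.Definable.exists_of_finite hp
  unfold DP
  convert this using 1
  ext v
  exact Coord.eqv.exists_congr_left

theorem DP.forall {p : E → F → Prop} (hp : DP L fun z : E × F => p z.1 z.2) :
    DP L fun x => ∀ y, p x y :=
  (DP.exists (p := fun x y => ¬ p x y) hp.not).not.congr fun _ => by simp

theorem DP.forall_finite {ι : Type} [Finite ι] {p : ι → E → Prop} (hp : ∀ i, DP L (p i)) :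
    DP L fun x => ∀ i, p i x := by
  have := Set.definable_iInter_of_finite hp
  unfold DP
  convert this using 1
  ext v
  simp

theorem DP.fst {p : E → Prop} (hp : DP L p) : DP L fun z : E × F => p z.1 :=
  hp.reindex Prod.fst Sum.inl fun _ _ => rfl

theorem DP.snd {p : F → Prop} (hp : DP L p) : DP L fun z : E × F => p z.2 :=
  hp.reindex Prod.snd Sum.inr fun _ _ => rfl

theorem DP.eq_pair : DP L fun z : E × E => z.1 = z.2 := by
  have h : ∀ i : Coord.idx E, DP L fun z : E × E => Coord.eqv z.1 i = Coord.eqv z.2 i := by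
    intro i
    refine ⟨(Language.Term.var (Sum.inl i)).equal (Language.Term.var (Sum.inr i)), ?_⟩
    ext v
    simp only [Set.mem_ofPred_eq, Language.Formula.realize_equal, Language.Term.realize_var]
    have h1 : Coord.eqv ((Coord.eqv (E := E × E)).symm v).1 = fun i => v (Sum.inl i) :=
      Equiv.apply_symm_apply _ _
    have h2 : Coord.eqv ((Coord.eqv (E := E × E)).symm v).2 = fun i => v (Sum.inr i) :=
      Equiv.apply_symm_apply _ _
    rw [h1, h2]
  refine (DP.forall_finite h).congr fun z => ?_
  rw [← Coord.eqv.injective.eq_iff, funext_iff]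

@[fun_prop]
theorem DF.id : DF L fun x : E => x :=
  DP.eq_pair.congr fun _ => eq_comm

theorem DF.graph_fst_snd {f : F → F'} (hf : DF L f) :
    DP L fun z : (E × F') × F => z.1.2 = f z.2 :=
  DP.reindex (E := (E × F') × F) hf (fun z => (z.2, z.1.2))
    (Sum.elim Sum.inr fun i => Sum.inl (Sum.inr i)) (by rintro x (j | j) <;> rfl)

theorem DF.graph_fst_fst {f : E → F} (hf : DF L f) :
    DP L fun z : (E × F') × F => z.2 = f z.1.1 :=
  DP.reindex (E := (E × F') × F) hf (fun z => (z.1.1, z.2))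
    (Sum.elim (fun i => Sum.inl (Sum.inl i)) Sum.inr) (by rintro x (j | j) <;> rfl)

@[fun_prop]
theorem DF.comp {g : F → F'} {f : E → F} (hg : DF L g) (hf : DF L f) :
    DF L fun x => g (f x) := by
  refine (DP.exists (p := fun (z : E × F') y => y = f z.1 ∧ z.2 = g y)
    (hf.graph_fst_fst.and hg.graph_fst_snd)).congr fun z => by simp

theorem DP.comp {p : F → Prop} {f : E → F} (hp : DP L p) (hf : DF L f) :
    DP L fun x => p (f x) := by
  refine (DP.exists (p := fun (z : E) y => y = f z ∧ p y)
    (DP.and hf hp.snd)).congr fun z => by simp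

theorem DF.fst' : DF L fun z : E × F => z.1 :=
  (DP.eq_pair (L := L) (E := E)).reindex (E := (E × F) × E) (fun z => (z.2, z.1.1))
    (Sum.elim Sum.inr fun i => Sum.inl (Sum.inl i)) (by rintro x (j | j) <;> rfl)

theorem DF.snd' : DF L fun z : E × F => z.2 :=
  (DP.eq_pair (L := L) (E := F)).reindex (E := (E × F) × F) (fun z => (z.2, z.1.2))
    (Sum.elim Sum.inr fun i => Sum.inl (Sum.inr i)) (by rintro x (j | j) <;> rfl)

@[fun_prop]
theorem DF.fst {f : E → F × F'} (hf : DF L f) : DF L fun x => (f x).1 := DF.fst'.comp hf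

@[fun_prop]
theorem DF.snd {f : E → F × F'} (hf : DF L f) : DF L fun x => (f x).2 := DF.snd'.comp hf

@[fun_prop]
theorem DF.prodMk {f : E → F} {g : E → F'} (hf : DF L f) (hg : DF L g) :
    DF L fun x => (f x, g x) := by
  have h1 : DP L fun z : E × F × F' => z.2.1 = f z.1 :=
    DP.comp (F := E × F) (f := fun z : E × F × F' => (z.1, z.2.1)) hf
      (DP.eq_pair.reindex (E := (E × F × F') × (E × F)) (fun z => (z.2, (z.1.1, z.1.2.1)))
        (Sum.elim Sum.inr (Sum.elim (fun i => Sum.inl (Sum.inl i))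
          fun i => Sum.inl (Sum.inr (Sum.inl i)))) (by rintro x (j | j | j) <;> rfl))
  have h2 : DP L fun z : E × F × F' => z.2.2 = g z.1 :=
    DP.comp (F := E × F') (f := fun z : E × F × F' => (z.1, z.2.2)) hg
      (DP.eq_pair.reindex (E := (E × F × F') × (E × F')) (fun z => (z.2, (z.1.1, z.1.2.2)))
        (Sum.elim Sum.inr (Sum.elim (fun i => Sum.inl (Sum.inl i))
          fun i => Sum.inl (Sum.inr (Sum.inr i)))) (by rintro x (j | j | j) <;> rfl))
  exact (h1.and h2).congr fun z => Prod.ext_iff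

@[fun_prop]
theorem DP.eq {f g : E → F} (hf : DF L f) (hg : DF L g) : DP L fun x => f x = g x :=
  DP.eq_pair.comp (hf.prodMk hg)

@[fun_prop]
theorem DF.const (c : F) : DF L fun _ : E => c := by
  have h : ∀ i : Coord.idx F, DP L fun z : F => Coord.eqv z i = Coord.eqv c i := by
    intro i
    refine ⟨(Language.Term.var i).equal
      (L.con (⟨Coord.eqv c i, trivial⟩ : (Set.univ : Set ℝ))).term, ?_⟩
    ext v
    simp
  refine DP.congr (DP.snd (E := E) (DP.forall_finite h)) fun z => ?_
  rw [← Coord.eqv.injective.eq_iff, funext_iff]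

@[fun_prop]
theorem DF.eval {n : ℕ} (i : Fin n) : DF L fun x : Fin n → ℝ => x i :=
  (DP.eq_pair (L := L) (E := ℝ)).reindex (E := (Fin n → ℝ) × ℝ) (fun z => (z.2, z.1 i))
    (Sum.elim Sum.inr fun _ => Sum.inl i) (by rintro x (j | j) <;> rfl)

theorem DF.apply {n : ℕ} {f : E → Fin n → ℝ} (hf : DF L f) (i : Fin n) :
    DF L fun x => f x i :=
  (DF.eval i).comp hf

@[fun_prop]
theorem DF.pi {n : ℕ} {f : E → Fin n → ℝ} (hf : ∀ i, DF L fun x => f x i) :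
    DF L fun x i => f x i := by
  refine (DP.forall_finite (p := fun i (z : E × (Fin n → ℝ)) => z.2 i = f z.1 i)
    fun i => ?_).congr fun z => funext_iff
  exact DP.eq (DF.apply DF.snd' i) ((hf i).comp DF.fst')

theorem DF.ite {p : E → Prop} {f g : E → F} [DecidablePred p] (hp : DP L p) (hf : DF L f)
    (hg : DF L g) : DF L fun x => if p x then f x else g x := by
  refine (((hp.fst (F := F)).and hf).or (hp.fst.not.and hg)).congr fun z => ?_
  by_cases h : p z.1 <;> simp [h]

/-- A function given on a definable set by a definable relation is definable after extension
by a constant. -/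
theorem DF.of_rel {p : E → Prop} {f : E → F} {R : E → F → Prop} (hp : DP L p)
    (hR : DP L fun z : E × F => R z.1 z.2) (c : F)
    (h : ∀ x, p x → ∀ y, y = f x ↔ R x y) (hc : ∀ x, ¬ p x → f x = c) : DF L f := by
  refine (((hp.fst (F := F)).and hR).or (hp.fst.not.and (DP.eq DF.snd' (DF.const c)))).congr
    fun z => ?_
  by_cases hz : p z.1
  · simp [hz, h z.1 hz]
  · simp [hz, hc z.1 hz]

section Field

variable [hL : Fact (ExpandsOrderedField L)]

@[fun_prop]
theorem DF.add {f g : E → ℝ} (hf : DF L f) (hg : DF L g) : DF L fun x => f x + g x := by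
  have h : DF L fun z : ℝ × ℝ => z.1 + z.2 :=
    (DP.reindex (F := Fin 3 → ℝ) (p := fun x => x 0 + x 1 = x 2) (E := (ℝ × ℝ) × ℝ) hL.out.2.1
      (fun z => ![z.1.1, z.1.2, z.2]) ![Sum.inl (Sum.inl ()), Sum.inl (Sum.inr ()), Sum.inr ()]
      (by intro x (j : Fin _); fin_cases j <;> rfl)).congr fun z => by simp [eq_comm]
  exact h.comp (hf.prodMk hg)

@[fun_prop]
theorem DF.mul {f g : E → ℝ} (hf : DF L f) (hg : DF L g) : DF L fun x => f x * g x := by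
  have h : DF L fun z : ℝ × ℝ => z.1 * z.2 :=
    (DP.reindex (F := Fin 3 → ℝ) (p := fun x => x 0 * x 1 = x 2) (E := (ℝ × ℝ) × ℝ) hL.out.2.2.1
      (fun z => ![z.1.1, z.1.2, z.2]) ![Sum.inl (Sum.inl ()), Sum.inl (Sum.inr ()), Sum.inr ()]
      (by intro x (j : Fin _); fin_cases j <;> rfl)).congr fun z => by simp [eq_comm]
  exact h.comp (hf.prodMk hg)

@[fun_prop]
theorem DP.lt {f g : E → ℝ} (hf : DF L f) (hg : DF L g) : DP L fun x => f x < g x := by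
  have h : DP L fun z : ℝ × ℝ => z.1 < z.2 :=
    DP.reindex (F := Fin 2 → ℝ) (p := fun x => x 0 < x 1) (E := ℝ × ℝ) hL.out.1
      (fun z => ![z.1, z.2]) ![Sum.inl (), Sum.inr ()] (by intro x (j : Fin _); fin_cases j <;> rfl)
  exact h.comp (hf.prodMk hg)

@[fun_prop]
theorem DP.le {f g : E → ℝ} (hf : DF L f) (hg : DF L g) : DP L fun x => f x ≤ g x :=
  (DP.lt hg hf).not.congr fun _ => not_lt.symm

@[fun_prop]
theorem DF.neg {f : E → ℝ} (hf : DF L f) : DF L fun x => -f x := by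
  have h : DF L fun x : ℝ => -x :=
    DP.congr (p := fun z : ℝ × ℝ => z.2 + z.1 = 0) (by fun_prop)
      fun z => by rw [eq_neg_iff_add_eq_zero]
  exact h.comp hf

@[fun_prop]
theorem DF.sub {f g : E → ℝ} (hf : DF L f) (hg : DF L g) : DF L fun x => f x - g x := by
  simp only [sub_eq_add_neg]
  fun_prop

@[fun_prop]
theorem DF.inv {f : E → ℝ} (hf : DF L f) : DF L fun x => (f x)⁻¹ := by
  have h : DF L fun x : ℝ => x⁻¹ := by
    refine DP.congr (p := fun z : ℝ × ℝ => (z.1 = 0 ∧ z.2 = 0) ∨ z.1 * z.2 = 1) (by fun_prop)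
      fun z => ?_
    by_cases hz : z.1 = 0
    · simp [hz]
    · simp only [hz, false_and, false_or]
      constructor
      · intro h
        rw [h]
        exact mul_inv_cancel₀ hz
      · exact eq_inv_of_mul_eq_one_right
  exact h.comp hf

@[fun_prop]
theorem DF.div {f g : E → ℝ} (hf : DF L f) (hg : DF L g) : DF L fun x => f x / g x := by
  simp only [div_eq_mul_inv]
  fun_prop

@[fun_prop]
theorem DF.pow {f : E → ℝ} (hf : DF L f) (k : ℕ) : DF L fun x => f x ^ k := by
  induction k with
  | zero => simpa using DF.const 1
  | succ k ih => simp only [pow_succ]; fun_prop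

@[fun_prop]
theorem DF.max {f g : E → ℝ} (hf : DF L f) (hg : DF L g) : DF L fun x => max (f x) (g x) := by
  simp only [max_def]
  exact DF.ite (DP.le hf hg) hg hf

@[fun_prop]
theorem DF.abs {f : E → ℝ} (hf : DF L f) : DF L fun x => |f x| := by
  simp only [abs_eq_max_neg]
  fun_prop

theorem DF.sum {ι : Type*} (s : Finset ι) {f : ι → E → ℝ} (hf : ∀ i, DF L (f i)) :
    DF L fun x => ∑ i ∈ s, f i x := by
  classical
  induction s using Finset.induction with
  | empty => simpa using DF.const 0
  | insert i s hi ih => simp only [Finset.sum_insert hi]; exact (hf i).add ih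

theorem DF.clm {n m : ℕ} (A : (Fin n → ℝ) →L[ℝ] (Fin m → ℝ)) : DF L fun x => A x := by
  refine DF.pi fun j => ?_
  have : (fun x => A x j) = fun x => ∑ i, x i * A (Pi.single i 1) j := by
    ext x
    conv_lhs => rw [← Finset.univ_sum_single x]
    simp only [map_sum, Finset.sum_apply]
    refine Finset.sum_congr rfl fun i _ => ?_
    have : (Pi.single i (x i) : Fin n → ℝ) = x i • Pi.single i 1 := by
      rw [← Pi.single_smul]; simp
    rw [this, map_smul]
    rfl
  rw [this]
  exact DF.sum _ fun i => (DF.eval i).mul (DF.const _)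

theorem DP.dist_lt {n : ℕ} {f g : E → Fin n → ℝ} {δ : E → ℝ} (hf : DF L f) (hg : DF L g)
    (hδ : DF L δ) : DP L fun x => dist (f x) (g x) < δ x := by
  refine (DP.and (DP.lt (DF.const 0) hδ)
    (DP.forall_finite (p := fun i x => |f x i - g x i| < δ x)
      fun i => DP.lt ((hf.apply i).sub (hg.apply i)).abs hδ)).congr
    fun x => ?_
  constructor
  · intro h
    have h0 : 0 < δ x := dist_nonneg.trans_lt h
    exact ⟨h0, (dist_pi_lt_iff h0).1 h⟩
  · rintro ⟨h0, h⟩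
    exact (dist_pi_lt_iff h0).2 h

end Field

theorem def_iff_DP {n : ℕ} {s : Set (Fin n → ℝ)} : Def L n s ↔ DP L (· ∈ s) := Iff.rfl

theorem DF.fstFun {m n : ℕ} : DF L (fstFun : (Fin (m + n) → ℝ) → Fin m → ℝ) :=
  DF.pi fun _ => DF.apply DF.id _

theorem DF.sndFun {m n : ℕ} : DF L (sndFun : (Fin (m + n) → ℝ) → Fin n → ℝ) :=
  DF.pi fun _ => DF.apply DF.id _

theorem fstFun_append {m n : ℕ} (a : Fin m → ℝ) (b : Fin n → ℝ) :
    Paper.fstFun (Fin.append a b) = a := by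
  ext i; simp [Paper.fstFun]

theorem sndFun_append {m n : ℕ} (a : Fin m → ℝ) (b : Fin n → ℝ) :
    Paper.sndFun (Fin.append a b) = b := by
  ext i; simp [Paper.sndFun]

theorem append_fstFun_sndFun {m n : ℕ} (z : Fin (m + n) → ℝ) :
    Fin.append (Paper.fstFun z) (Paper.sndFun z) = z :=
  Fin.append_castAdd_natAdd

theorem DF.append {m n : ℕ} {f : E → Fin m → ℝ} {g : E → Fin n → ℝ} (hf : DF L f)
    (hg : DF L g) : DF L fun x => Fin.append (f x) (g x) :=
  DF.pi fun i => by
    induction i using Fin.addCases with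
    | left i => simpa only [Fin.append_left] using hf.apply i
    | right i => simpa only [Fin.append_right] using hg.apply i

theorem defMapOn_iff {m n : ℕ} {X : Set (Fin m → ℝ)} {f : (Fin m → ℝ) → (Fin n → ℝ)} :
    DefMapOn L m n X f ↔ DP L fun z : (Fin m → ℝ) × (Fin n → ℝ) => z.1 ∈ X ∧ z.2 = f z.1 := by
  constructor
  · intro h
    refine (DP.comp (def_iff_DP.1 h) (DF.append DF.fst' DF.snd')).congr fun z => ?_
    simp [fstFun_append, sndFun_append]
  · intro h
    exact DP.comp h (DF.prodMk DF.fstFun DF.sndFun)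

theorem DefMapOn.of_DF {m n : ℕ} {X : Set (Fin m → ℝ)} {f : (Fin m → ℝ) → (Fin n → ℝ)}
    (hX : DP L (· ∈ X)) (hf : DF L f) : DefMapOn L m n X f :=
  defMapOn_iff.2 (hX.fst.and hf)

open Classical in
/-- A definable map on a definable set agrees there with a total definable map. -/
theorem DefMapOn.exists_DF {m n : ℕ} {X : Set (Fin m → ℝ)} {f : (Fin m → ℝ) → (Fin n → ℝ)}
    (hX : DP L (· ∈ X)) (hf : DefMapOn L m n X f) :
    ∃ g : (Fin m → ℝ) → (Fin n → ℝ), DF L g ∧ Set.EqOn g f X := by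
  refine ⟨fun x => if x ∈ X then f x else 0, ?_, fun x hx => if_pos hx⟩
  refine DF.of_rel (R := fun x y => x ∈ X ∧ y = f x) hX (defMapOn_iff.1 hf) 0
    (fun x hx y => ?_) fun x hx => if_neg hx
  simp [hx]

section Generic
open Filter

/-- Every nonempty open set contains a nonempty open set with the property `Q`. -/
def Generic {n : ℕ} (Q : Set (Fin n → ℝ) → Prop) : Prop :=
  ∀ O : Set (Fin n → ℝ), IsOpen O → O.Nonempty → ∃ O' ⊆ O, IsOpen O' ∧ O'.Nonempty ∧ Q O'

theorem Generic.forall_finite {n : ℕ} {ι : Type*} [Finite ι] {Q : ι → Set (Fin n → ℝ) → Prop}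
    (hQ : ∀ i, Generic (Q i)) (hmono : ∀ i O O', O' ⊆ O → Q i O → Q i O') :
    Generic fun O => ∀ i, Q i O := by
  classical
  have := Fintype.ofFinite ι
  intro O hO hne
  have : ∀ s : Finset ι, ∃ O' ⊆ O, IsOpen O' ∧ O'.Nonempty ∧ ∀ i ∈ s, Q i O' := by
    intro s
    induction s using Finset.induction with
    | empty => exact ⟨O, subset_rfl, hO, hne, by simp⟩
    | insert i s _ ih =>
      obtain ⟨O1, h1, h2, h3, h4⟩ := ih
      obtain ⟨O2, h5, h6, h7, h8⟩ := hQ i O1 h2 h3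
      refine ⟨O2, h5.trans h1, h6, h7, ?_⟩
      intro j hj
      rcases Finset.mem_insert.1 hj with rfl | hj
      · exact h8
      · exact hmono j _ _ h5 (h4 j hj)
  obtain ⟨O', h1, h2, h3, h4⟩ := this Finset.univ
  exact ⟨O', h1, h2, h3, fun i => h4 i (Finset.mem_univ i)⟩

theorem exists_open_of_cover_of_dichotomy {n : ℕ} {ι : Type*} [Countable ι]
    (hD : ∀ p : (Fin n → ℝ) → Prop, DP L p →
      Generic fun O => (∀ x ∈ O, p x) ∨ ∀ x ∈ O, ¬ p x)
    {A : ι → (Fin n → ℝ) → Prop} (hA : ∀ k, DP L (A k)) {O : Set (Fin n → ℝ)} (hOo : IsOpen O)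
    (hne : O.Nonempty) (hcov : ∀ x ∈ O, ∃ k, A k x) :
    ∃ k, ∃ O' ⊆ O, IsOpen O' ∧ O'.Nonempty ∧ ∀ x ∈ O', A k x := by
  by_contra! hcon
  let U : ι → Set (Fin n → ℝ) := fun k => interior {x | ¬ A k x} ∪ (closure O)ᶜ
  have hUo : ∀ k, IsOpen (U k) := fun k => isOpen_interior.union isClosed_closure.isOpen_compl
  have hUd : ∀ k, Dense (U k) := by
    intro k
    rw [dense_iff_inter_open]
    intro V hV hVne
    by_cases h : (V ∩ O).Nonempty
    · obtain ⟨O', h1, h2, h3, h4⟩ := hD _ (hA k) _ (hV.inter hOo) h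
      rcases h4 with h4 | h4
      · obtain ⟨x, hx, hx'⟩ := hcon k O' (h1.trans inter_subset_right) h2 h3
        exact absurd (h4 x hx) hx'
      · obtain ⟨x, hx⟩ := h3
        exact ⟨x, (h1 hx).1, Or.inl (mem_interior.2 ⟨O', h4, h2, hx⟩)⟩
    · obtain ⟨x, hx⟩ := hVne
      refine ⟨x, hx, Or.inr fun hx' => h ?_⟩
      exact mem_closure_iff.1 hx' V hV hx
  obtain ⟨x, hxO, hx⟩ := (dense_iInter_of_isOpen hUo hUd).inter_open_nonempty O hOo hne
  obtain ⟨k, hk⟩ := hcov x hxO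
  rcases mem_iInter.1 hx k with h | h
  · exact interior_subset h hk
  · exact h (subset_closure hxO)

variable [hO : Fact (LocallyOMinimal L)]

/-- A definable predicate on `ℝ` is eventually true or eventually false to the right of each
point. -/
theorem DP.right_dichotomy {p : ℝ → Prop} (hp : DP L p) (a : ℝ) :
    ∃ b > a, (∀ x ∈ Ioo a b, p x) ∨ ∀ x ∈ Ioo a b, ¬ p x := by
  have h1 : Def1 L {x | p x} := hp.comp (DF.eval (0 : Fin 1))
  obtain ⟨b, c, hb, hc, P, J, hJ⟩ := hO.out _ h1 a
  have hac : ∀ᶠ x in 𝓝[>] a, x ∈ Ioo b c :=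
    nhdsWithin_le_nhds (Ioo_mem_nhds hb hc)
  have key : (∀ᶠ x in 𝓝[>] a, p x) ∨ ∀ᶠ x in 𝓝[>] a, ¬ p x := by
    by_cases h : ∃ q ∈ J, q.1 ≤ a ∧ a < q.2
    · obtain ⟨q, hq, hq1, hq2⟩ := h
      left
      filter_upwards [Ioo_mem_nhdsGT hq2] with x hx
      have : x ∈ {x | p x} ∩ Ioo b c := by
        rw [hJ]
        exact Or.inr (mem_biUnion hq ⟨hq1.trans_lt hx.1, hx.2⟩)
      exact this.1
    · right
      have hP : ∀ᶠ x in 𝓝[>] a, ∀ y ∈ P, x ≠ y := by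
        rw [Filter.eventually_all_finset]
        intro y _
        by_cases hy : y ≤ a
        · filter_upwards [self_mem_nhdsWithin] with x hx
          exact (hy.trans_lt hx).ne'
        · filter_upwards [Ioo_mem_nhdsGT (not_le.1 hy)] with x hx
          exact hx.2.ne
      have hJ' : ∀ᶠ x in 𝓝[>] a, ∀ q ∈ J, x ∉ Ioo q.1 q.2 := by
        rw [Filter.eventually_all_finset]
        intro q hq
        by_cases hq1 : q.1 ≤ a
        · have hq2 : q.2 ≤ a := not_lt.1 fun h' => h ⟨q, hq, hq1, h'⟩
          filter_upwards [self_mem_nhdsWithin] with x hx hx'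
          exact absurd (hx'.2.trans_le hq2) (not_lt.2 (le_of_lt hx))
        · filter_upwards [Ioo_mem_nhdsGT (not_le.1 hq1)] with x hx hx'
          exact absurd hx'.1 (not_lt.2 hx.2.le)
      filter_upwards [hac, hP, hJ'] with x hx hxP hxJ hpx
      have : x ∈ {x | p x} ∩ Ioo b c := ⟨hpx, hx⟩
      rw [hJ] at this
      rcases this with h' | h'
      · exact hxP x h' rfl
      · simp only [mem_iUnion] at h'
        obtain ⟨q, hq, hxq⟩ := h'
        exact hxJ q hq hxq
  rcases key with h | h
  · obtain ⟨u, hu, hu'⟩ := mem_nhdsGT_iff_exists_Ioo_subset.1 h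
    exact ⟨u, hu, Or.inl fun x hx => hu' hx⟩
  · obtain ⟨u, hu, hu'⟩ := mem_nhdsGT_iff_exists_Ioo_subset.1 h
    exact ⟨u, hu, Or.inr fun x hx => hu' hx⟩

variable [hL : Fact (ExpandsOrderedField L)]

/-- A definable predicate is generically true or generically false. -/
theorem DP.generic_dichotomy {n : ℕ} {p : (Fin n → ℝ) → Prop} (hp : DP L p) :
    Generic fun O => (∀ x ∈ O, p x) ∨ ∀ x ∈ O, ¬ p x := by
  induction n with
  | zero =>
    intro O hOo hne
    refine ⟨O, subset_rfl, hOo, hne, ?_⟩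
    by_cases h : p default
    · exact Or.inl fun x _ => by rwa [Subsingleton.elim x default]
    · exact Or.inr fun x _ => by rwa [Subsingleton.elim x default]
  | succ n ih =>
    intro O hOo hne
    obtain ⟨x₀, hx₀⟩ := hne
    obtain ⟨ε, hε, hball⟩ := Metric.isOpen_iff.1 hOo x₀ hx₀
    set a := x₀ 0 with ha
    have hcons : DF L fun z : (Fin n → ℝ) × ℝ => (Fin.cons z.2 z.1 : Fin (n + 1) → ℝ) :=
      DF.pi fun i => by
        induction i using Fin.cases with
        | zero => simpa only [Fin.cons_zero] using DF.snd'
        | succ i => simpa only [Fin.cons_succ] using DF.fst'.apply i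
    let q : Bool → (Fin (n + 1) → ℝ) → Prop := fun b x => if b then p x else ¬ p x
    have hq : ∀ b, DP L (q b) := by
      rintro (_ | _)
      · simpa [q] using hp.not
      · simpa [q] using hp
    let A : ℕ × Bool → (Fin n → ℝ) → Prop := fun k x =>
      ∀ s : ℝ, a < s → s < a + 1 / ((k.1 : ℝ) + 1) → q k.2 (Fin.cons s x : Fin (n + 1) → ℝ)
    have hA : ∀ k, DP L (A k) := fun k =>
      DP.forall ((DP.lt (DF.const a) DF.snd').imp
        ((DP.lt DF.snd' (DF.const _)).imp ((hq k.2).comp hcons)))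
    obtain ⟨k, O', h1, h2, h3, h4⟩ := exists_open_of_cover_of_dichotomy (fun p hp => ih hp) hA
      (Metric.isOpen_ball (x := Fin.tail x₀) (ε := ε)) ⟨_, Metric.mem_ball_self hε⟩ (by
        intro x _
        have hs : DP L fun s : ℝ => p (Fin.cons s x : Fin (n + 1) → ℝ) :=
          hp.comp (hcons.comp ((DF.const x).prodMk DF.id))
        obtain ⟨b, hb, hb'⟩ := hs.right_dichotomy a
        obtain ⟨m, hm⟩ := exists_nat_one_div_lt (sub_pos.2 hb)
        rcases hb' with hb' | hb'
        · exact ⟨(m, true), fun s hs1 hs2 => by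
            simpa [q] using hb' s ⟨hs1, by linarith⟩⟩
        · exact ⟨(m, false), fun s hs1 hs2 => by
            simpa [q] using hb' s ⟨hs1, by linarith⟩⟩)
    have hpos : (0 : ℝ) < min (1 / ((k.1 : ℝ) + 1)) ε := lt_min (by positivity) hε
    have hA' : ∀ x ∈ {v : Fin (n + 1) → ℝ | (a < v 0 ∧ v 0 < a + min (1 / ((k.1 : ℝ) + 1)) ε) ∧
        Fin.tail v ∈ O'}, q k.2 x := by
      rintro v ⟨⟨hv1, hv2⟩, hv3⟩
      have := h4 _ hv3 (v 0) hv1 (hv2.trans_le (by gcongr; exact min_le_left _ _))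
      rwa [Fin.cons_self_tail] at this
    refine ⟨{v : Fin (n + 1) → ℝ | (a < v 0 ∧ v 0 < a + min (1 / ((k.1 : ℝ) + 1)) ε) ∧
        Fin.tail v ∈ O'}, ?_, ?_, ?_, ?_⟩
    · rintro v ⟨⟨hv1, hv2⟩, hv3⟩
      apply hball
      rw [Metric.mem_ball, dist_pi_lt_iff hε]
      intro i
      induction i using Fin.cases with
      | zero =>
        rw [Real.dist_eq, abs_lt]
        have := min_le_right (1 / ((k.1 : ℝ) + 1)) ε
        constructor <;> linarith
      | succ i => exact (dist_pi_lt_iff hε).1 (h1 hv3) i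
    · refine IsOpen.inter (IsOpen.inter ?_ ?_) ?_
      · exact isOpen_lt continuous_const (continuous_apply 0)
      · exact isOpen_lt (continuous_apply 0) continuous_const
      · exact h2.preimage (continuous_pi fun i => continuous_apply i.succ)
    · obtain ⟨y, hy⟩ := h3
      exact ⟨(Fin.cons (a + min (1 / ((k.1 : ℝ) + 1)) ε / 2) y : Fin (n + 1) → ℝ),
        ⟨by simpa only [Fin.cons_zero] using ⟨by linarith, by linarith⟩, by simpa using hy⟩⟩
    · rcases k with ⟨k, _ | _⟩
      · exact Or.inr fun x hx => by simpa [q] using hA' x hx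
      · exact Or.inl fun x hx => by simpa [q] using hA' x hx

theorem exists_open_of_cover {n : ℕ} {ι : Type*} [Countable ι]
    {A : ι → (Fin n → ℝ) → Prop} (hA : ∀ k, DP L (A k)) {O : Set (Fin n → ℝ)} (hOo : IsOpen O)
    (hne : O.Nonempty) (hcov : ∀ x ∈ O, ∃ k, A k x) :
    ∃ k, ∃ O' ⊆ O, IsOpen O' ∧ O'.Nonempty ∧ ∀ x ∈ O', A k x :=
  exists_open_of_cover_of_dichotomy (fun _ hp => hp.generic_dichotomy) hA hOo hne hcov

theorem DF.generic_continuousOn {n m : ℕ} {f : (Fin n → ℝ) → (Fin m → ℝ)} (hf : DF L f) :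
    Generic fun O => ContinuousOn f O := by
  intro O hOo hne
  let C : ℝ → (Fin n → ℝ) → Prop := fun ε x => ∃ δ : ℝ, 0 < δ ∧
    ∀ y, dist y x < δ → dist (f y) (f x) < ε
  have hC : DP L fun z : (Fin n → ℝ) × ℝ => C z.2 z.1 := by
    refine DP.exists ((DP.lt (DF.const 0) DF.snd').and (DP.forall (DP.imp ?_ ?_)))
    · exact DP.dist_lt DF.snd' DF.fst'.fst.fst DF.fst'.snd
    · exact DP.dist_lt (hf.comp DF.snd') (hf.comp DF.fst'.fst.fst) DF.fst'.fst.snd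
  have hC1 : ∀ ε, DP L (C ε) := fun ε => hC.comp (DF.id.prodMk (DF.const ε))
  have hCa : DP L fun x => ∀ ε : ℝ, 0 < ε → C ε x :=
    DP.forall ((DP.lt (DF.const 0) DF.snd').imp hC)
  have hcont : ∀ x, (∀ ε : ℝ, 0 < ε → C ε x) → ContinuousAt f x := fun x hx =>
    Metric.continuousAt_iff.2 fun ε hε => by
      obtain ⟨δ, hδ, h⟩ := hx ε hε
      exact ⟨δ, hδ, fun {y} hy => h y hy⟩
  obtain ⟨O1, h1, h2, h3, h4 | h4⟩ := hCa.generic_dichotomy O hOo hne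
  · exact ⟨O1, h1, h2, h3, fun x hx => (hcont x (h4 x hx)).continuousWithinAt⟩
  exfalso
  obtain ⟨k, O2, -, h6, h7, h8⟩ := exists_open_of_cover (A := fun (k : ℕ) x => ¬ C (1 / (k + 1)) x)
    (fun k => (hC1 _).not) h2 h3 (by
      intro x hx
      have := h4 x hx
      push Not at this
      obtain ⟨ε, hε, hx'⟩ := this
      obtain ⟨k, hk⟩ := exists_nat_one_div_lt hε
      refine ⟨k, fun ⟨δ, hδ, h⟩ => hx' ⟨δ, hδ, fun y hy => (h y hy).trans hk⟩⟩)
  obtain ⟨q, O3, h9, h10, ⟨x, hx⟩, h12⟩ := exists_open_of_cover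
    (A := fun (j : ℕ) x => dist (f x) (TopologicalSpace.denseSeq (Fin m → ℝ) j) < 1 / (k + 1) / 2)
    (fun j => DP.dist_lt hf (DF.const _) (DF.const _)) h6 h7 (by
      intro x _
      have hpos : (0 : ℝ) < 1 / (k + 1) / 2 := by positivity
      exact (TopologicalSpace.denseRange_denseSeq _).exists_dist_lt (f x) hpos)
  obtain ⟨δ, hδ, hball⟩ := Metric.isOpen_iff.1 h10 x hx
  refine h8 x (h9 hx) ⟨δ, hδ, fun y hy => ?_⟩
  have hy' := h12 y (hball hy)
  have hx' := h12 x hx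
  have := dist_triangle_right (f y) (f x) (TopologicalSpace.denseSeq (Fin m → ℝ) q)
  linarith

end Generic

section Smooth

theorem monotoneOn_of_forall_right_le {g : ℝ → ℝ} {a b : ℝ} (hc : ContinuousOn g (Ioo a b))
    (h : ∀ x ∈ Ioo a b, ∃ c > x, ∀ y ∈ Ioo x c, g x ≤ g y) : MonotoneOn g (Ioo a b) := by
  intro x hx y hy hxy
  have hsub : Icc x y ⊆ Ioo a b := fun z hz => ⟨hx.1.trans_le hz.1, hz.2.trans_lt hy.2⟩
  have hcl : IsClosed ({z | g x ≤ g z} ∩ Icc x y) := by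
    have := (hc.mono hsub).preimage_isClosed_of_isClosed isClosed_Icc (isClosed_Ici (a := g x))
    rw [inter_comm]
    exact this
  refine hcl.Icc_subset_of_forall_mem_nhdsWithin (le_refl (g x)) ?_ ⟨hxy, le_rfl⟩
  rintro z ⟨hz, hz'⟩
  obtain ⟨c, hc, hc'⟩ := h z (hsub (Ico_subset_Icc_self hz'))
  filter_upwards [Ioo_mem_nhdsGT hc] with w hw
  exact le_trans hz (hc' w hw)

theorem exists_differentiableAt_of_monotoneOn {g : ℝ → ℝ} {a b : ℝ} (hab : a < b)
    (h : MonotoneOn g (Ioo a b)) : ∃ x ∈ Ioo a b, DifferentiableAt ℝ g x := by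
  have h1 := h.ae_differentiableWithinAt measurableSet_Ioo
  have : NeZero (MeasureTheory.volume.restrict (Ioo a b)) := ⟨by
    rw [Ne, MeasureTheory.Measure.restrict_eq_zero]
    simp [hab]⟩
  obtain ⟨x, hx, hx'⟩ := (h1.and (MeasureTheory.ae_restrict_mem measurableSet_Ioo)).exists
  exact ⟨x, hx', hx.differentiableAt (isOpen_Ioo.mem_nhds hx')⟩

theorem abs_le_of_partials {n : ℕ} {f : (Fin n → ℝ) → ℝ} {D : Fin n → (Fin n → ℝ) → ℝ}
    {x y : Fin n → ℝ} {δ ε : ℝ} (hy : y ∈ Metric.ball x δ)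
    (hf : ∀ z ∈ Metric.ball x δ, ∀ i, HasDerivAt (fun s => f (Function.update z i s)) (D i z) (z i))
    (hD : ∀ z ∈ Metric.ball x δ, ∀ i, |D i z - D i x| ≤ ε) :
    |f y - f x - ∑ i, D i x * (y i - x i)| ≤ n * ε * ‖y - x‖ := by
  have hδ : 0 < δ := dist_nonneg.trans_lt hy
  have key : ∀ s : Finset (Fin n), |f (s.piecewise y x) - f x - ∑ i ∈ s, D i x * (y i - x i)| ≤
      s.card * ε * ‖y - x‖ := by
    intro s
    induction s using Finset.induction with
    | empty => simp
    | insert j s hj ih =>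
      set z := s.piecewise y x with hz
      have hzj : z j = x j := Finset.piecewise_eq_of_notMem _ _ _ hj
      have hball : ∀ t ∈ Metric.ball (x j) δ, Function.update z j t ∈ Metric.ball x δ := by
        intro t ht
        rw [Metric.mem_ball, dist_pi_lt_iff hδ]
        intro i
        by_cases hi : i = j
        · subst hi; simpa using ht
        · rw [Function.update_of_ne hi]
          by_cases his : i ∈ s
          · rw [hz, Finset.piecewise_eq_of_mem _ _ _ his]
            exact (dist_le_pi_dist y x i).trans_lt hy
          · rw [hz, Finset.piecewise_eq_of_notMem _ _ _ his]
            simpa using hδ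
      have hmv := Convex.norm_image_sub_le_of_norm_hasDerivWithin_le
        (f := fun t => f (Function.update z j t) - D j x * t)
        (f' := fun t => D j (Function.update z j t) - D j x) (C := ε)
        (s := Metric.ball (x j) δ) (x := x j) (y := y j) (by
          intro t ht
          have h1 := hf _ (hball t ht) j
          simp only [Function.update_idem, Function.update_self] at h1
          exact (h1.sub (by simpa using (hasDerivAt_id t).const_mul (D j x))).hasDerivWithinAt)
        (fun t ht => hD _ (hball t ht) j) (convex_ball _ _) (Metric.mem_ball_self hδ)
        ((dist_le_pi_dist y x j).trans_lt hy)
      have hε : 0 ≤ ε := (abs_nonneg _).trans (hD x (Metric.mem_ball_self hδ) j)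
      have hn : ‖y j - x j‖ ≤ ‖y - x‖ := norm_le_pi_norm (y - x) j
      rw [Finset.piecewise_insert, Finset.sum_insert hj, Finset.card_insert_of_notMem hj, ← hz]
      have e1 : Function.update z j (x j) = z := by rw [← hzj, Function.update_eq_self]
      simp only [e1] at hmv
      rw [Real.norm_eq_abs] at hmv
      have h3 : ε * ‖y j - x j‖ ≤ ε * ‖y - x‖ := by gcongr
      push_cast
      rw [abs_le] at *
      constructor <;> nlinarith
  simpa using key Finset.univ

theorem hasFDerivAt_of_partials {n : ℕ} {f : (Fin n → ℝ) → ℝ} {D : Fin n → (Fin n → ℝ) → ℝ}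
    {O : Set (Fin n → ℝ)} (hO : IsOpen O) (hD : ∀ i, ContinuousOn (D i) O)
    (hf : ∀ z ∈ O, ∀ i, HasDerivAt (fun s => f (Function.update z i s)) (D i z) (z i))
    {x : Fin n → ℝ} (hx : x ∈ O) :
    HasFDerivAt f (∑ i, D i x • ContinuousLinearMap.proj (R := ℝ) (φ := fun _ : Fin n => ℝ) i)
      x := by
  rw [hasFDerivAt_iff_isLittleO, Asymptotics.isLittleO_iff]
  intro c hc
  have h1 : ∀ᶠ z in 𝓝 x, ∀ i, |D i z - D i x| ≤ c / (n + 1) := by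
    rw [Filter.eventually_all]
    intro i
    have := ((hD i).continuousAt (hO.mem_nhds hx)).eventually
      (Metric.closedBall_mem_nhds _ (show 0 < c / (n + 1) by positivity))
    exact this
  obtain ⟨δ, hδ, h2⟩ := Metric.eventually_nhds_iff_ball.1 (h1.and (hO.mem_nhds hx))
  filter_upwards [Metric.ball_mem_nhds x hδ] with y hy
  have h3 := abs_le_of_partials hy (fun z hz => hf z (h2 z hz).2) (fun z hz => (h2 z hz).1)
  rw [Real.norm_eq_abs]
  have h4 : (n : ℝ) * (c / (n + 1)) ≤ c := by
    rw [mul_div_assoc', div_le_iff₀ (by positivity)]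
    nlinarith
  calc _ = |f y - f x - ∑ i, D i x * (y i - x i)| := by simp
    _ ≤ _ := h3
    _ ≤ _ := by gcongr

theorem DF.update {n : ℕ} (i : Fin n) :
    DF L fun z : (Fin n → ℝ) × ℝ => Function.update z.1 i z.2 := by
  refine DF.pi fun j => ?_
  by_cases h : j = i
  · subst h; simpa using DF.snd'
  · simpa [Function.update_of_ne h] using DF.fst'.apply j

variable [hL : Fact (ExpandsOrderedField L)]

/-- The `i`-th partial derivative. -/
noncomputable def partialDeriv {n : ℕ} (f : (Fin n → ℝ) → ℝ) (i : Fin n) (x : Fin n → ℝ) : ℝ :=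
  deriv (fun s => f (Function.update x i s)) (x i)

theorem DP.hasDerivAt_update {n : ℕ} {f : (Fin n → ℝ) → ℝ} (hf : DF L f) (i : Fin n) :
    DP L fun z : (Fin n → ℝ) × ℝ =>
      HasDerivAt (fun s => f (Function.update z.1 i s)) z.2 (z.1 i) := by
  have h1 : DP L fun z : (Fin n → ℝ) × ℝ => ∀ ε : ℝ, 0 < ε → ∃ δ : ℝ, 0 < δ ∧ ∀ s : ℝ,
      |s - z.1 i| < δ → |f (Function.update z.1 i s) - f z.1 - (s - z.1 i) * z.2| ≤
        ε * |s - z.1 i| := by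
    refine DP.forall ((DP.lt (DF.const 0) DF.snd').imp (DP.exists
      ((DP.lt (DF.const 0) DF.snd').and (DP.forall ?_))))
    have hs : DF L fun w : ((((Fin n → ℝ) × ℝ) × ℝ) × ℝ) × ℝ => w.2 - w.1.1.1.1 i :=
      DF.snd'.sub (DF.fst'.fst.fst.fst.apply i)
    refine (DP.lt hs.abs DF.fst'.snd).imp (DP.le (DF.abs (((DF.sub ?_ ?_)).sub
      (hs.mul DF.fst'.fst.fst.snd))) (DF.fst'.fst.snd.mul hs.abs))
    · exact hf.comp ((DF.update i).comp (DF.fst'.fst.fst.fst.prodMk DF.snd'))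
    · exact hf.comp DF.fst'.fst.fst.fst
  refine h1.congr fun z => ?_
  rw [hasDerivAt_iff_isLittleO, Asymptotics.isLittleO_iff]
  refine forall_congr' fun ε => imp_congr_right fun _ => ?_
  rw [Metric.eventually_nhds_iff]
  simp [Real.dist_eq]

theorem DF.partialDeriv {n : ℕ} {f : (Fin n → ℝ) → ℝ} (hf : DF L f) (i : Fin n) :
    DF L (partialDeriv f i) := by
  refine DF.of_rel (p := fun x => ∃ c, HasDerivAt (fun s => f (Function.update x i s)) c (x i))
    (R := fun x c => HasDerivAt (fun s => f (Function.update x i s)) c (x i))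
    (DP.exists (DP.hasDerivAt_update hf i)) (DP.hasDerivAt_update hf i) 0 ?_ ?_
  · rintro x ⟨c, hc⟩ y
    constructor
    · rintro rfl
      exact hc.differentiableAt.hasDerivAt
    · exact fun h => h.deriv.symm
  · intro x hx
    refine deriv_zero_of_not_differentiableAt fun h => hx ⟨_, h.hasDerivAt⟩

variable [hO : Fact (LocallyOMinimal L)]

theorem DF.exists_differentiableAt {g : ℝ → ℝ} (hg : DF L g) {a b : ℝ} (hab : a < b)
    (hc : ContinuousOn g (Ioo a b)) : ∃ x ∈ Ioo a b, DifferentiableAt ℝ g x := by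
  have hp : DP L fun x => ∃ c, x < c ∧ ∀ y, x < y → y < c → g x ≤ g y := by
    refine DP.exists ((DP.lt DF.fst' DF.snd').and (DP.forall ?_))
    refine (DP.lt DF.fst'.fst DF.snd').imp ((DP.lt DF.snd' DF.fst'.snd).imp (DP.le ?_ ?_))
    · exact hg.comp DF.fst'.fst
    · exact hg.comp DF.snd'
  obtain ⟨b', hb', h⟩ := hp.right_dichotomy a
  have hsub : Ioo a (min b b') ⊆ Ioo a b := Ioo_subset_Ioo_right (min_le_left _ _)
  have hsub' : Ioo a (min b b') ⊆ Ioo a b' := Ioo_subset_Ioo_right (min_le_right _ _)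
  have hlt : a < min b b' := lt_min hab hb'
  rcases h with h | h
  · obtain ⟨x, hx, hd⟩ := exists_differentiableAt_of_monotoneOn hlt
      (monotoneOn_of_forall_right_le (hc.mono hsub) fun x hx => by
        obtain ⟨c, hc, h'⟩ := h x (hsub' hx)
        exact ⟨c, hc, fun y hy => h' y hy.1 hy.2⟩)
    exact ⟨x, hsub hx, hd⟩
  · obtain ⟨x, hx, hd⟩ := exists_differentiableAt_of_monotoneOn (g := -g) hlt
      (monotoneOn_of_forall_right_le (hc.mono hsub).neg fun x hx => by
        obtain ⟨c, hc, h'⟩ := (DP.le (DF.const (g x)) hg).right_dichotomy x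
        rcases h' with h' | h'
        · exact absurd ⟨c, hc, fun y hy hy' => h' y ⟨hy, hy'⟩⟩ (h x (hsub' hx))
        · exact ⟨c, hc, fun y hy => neg_le_neg (le_of_lt (not_le.1 (h' y hy)))⟩)
    exact ⟨x, hsub hx, by simpa using hd.neg⟩

theorem DF.generic_hasDerivAt {n : ℕ} {f : (Fin n → ℝ) → ℝ} (hf : DF L f) (i : Fin n) :
    Generic fun O => ∀ x ∈ O,
      HasDerivAt (fun s => f (Function.update x i s)) (Paper.partialDeriv f i x) (x i) := by
  intro O hOo hne
  have hf' : DF L fun x => (fun _ : Fin 1 => f x) := DF.pi fun _ => hf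
  obtain ⟨O1, h1, h2, h3, h4⟩ := hf'.generic_continuousOn O hOo hne
  have hp : DP L fun x => ∃ c, HasDerivAt (fun s => f (Function.update x i s)) c (x i) :=
    DP.exists (DP.hasDerivAt_update hf i)
  obtain ⟨O2, h5, h6, h7, h8⟩ := hp.generic_dichotomy O1 h2 h3
  rcases h8 with h8 | h8
  · refine ⟨O2, h5.trans h1, h6, h7, fun x hx => ?_⟩
    obtain ⟨c, hc⟩ := h8 x hx
    exact hc.differentiableAt.hasDerivAt
  · exfalso
    obtain ⟨x, hx⟩ := h7
    obtain ⟨ε, hε, hball⟩ := Metric.isOpen_iff.1 h6 x hx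
    have hmem : ∀ s ∈ Ioo (x i - ε) (x i + ε), Function.update x i s ∈ O2 := by
      intro s hs
      apply hball
      rw [Metric.mem_ball, dist_pi_lt_iff hε]
      intro j
      by_cases h : j = i
      · subst h
        rw [Function.update_self, Real.dist_eq, abs_lt]
        constructor <;> linarith [hs.1, hs.2]
      · simpa [Function.update_of_ne h] using hε
    obtain ⟨s, hs, hd⟩ := DF.exists_differentiableAt (L := L)
      (g := fun s => f (Function.update x i s)) (a := x i - ε) (b := x i + ε)
      (hf.comp ((DF.update i).comp ((DF.const x).prodMk DF.id))) (by linarith) (by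
        have hf1 : ContinuousOn f O1 := (continuous_apply (0 : Fin 1)).comp_continuousOn h4
        refine hf1.comp (Continuous.continuousOn ?_) fun s hs => h5 (hmem s hs)
        exact continuous_const.update i continuous_id)
    refine h8 _ (hmem s hs) ⟨deriv (fun s => f (Function.update x i s)) s, ?_⟩
    simpa using hd.hasDerivAt

theorem DF.generic_contDiffOn_real {n : ℕ} (r : ℕ) {f : (Fin n → ℝ) → ℝ} (hf : DF L f) :
    Generic fun O => ContDiffOn ℝ r f O := by
  induction r generalizing f with
  | zero =>
    intro O hOo hne
    have hf' : DF L fun x => (fun _ : Fin 1 => f x) := DF.pi fun _ => hf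
    obtain ⟨O1, h1, h2, h3, h4⟩ := hf'.generic_continuousOn O hOo hne
    refine ⟨O1, h1, h2, h3, ?_⟩
    exact contDiffOn_zero.2 ((continuous_apply (0 : Fin 1)).comp_continuousOn h4)
  | succ r ih =>
    intro O hOo hne
    obtain ⟨O1, h1, h2, h3, h4⟩ := Generic.forall_finite (fun i => hf.generic_hasDerivAt i)
      (fun i O O' h h' x hx => h' x (h hx)) O hOo hne
    obtain ⟨O2, h5, h6, h7, h8⟩ := Generic.forall_finite (fun i => ih (hf.partialDeriv i))
      (fun i O O' h h' => h'.mono h) O1 h2 h3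
    refine ⟨O2, h5.trans h1, h6, h7, ?_⟩
    have hfd : ∀ x ∈ O2, HasFDerivAt f _ x := fun x hx =>
      hasFDerivAt_of_partials h6 (fun i => (h8 i).continuousOn) (fun z hz i => h4 i z (h5 hz)) hx
    push_cast
    rw [contDiffOn_succ_iff_fderiv_of_isOpen h6]
    refine ⟨fun x hx => (hfd x hx).differentiableAt.differentiableWithinAt, by simp, ?_⟩
    refine ContDiffOn.congr ?_ fun x hx => (hfd x hx).fderiv
    exact ContDiffOn.sum fun i _ => (h8 i).smul contDiffOn_const

/-- Definable maps are generically smooth. -/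
theorem DF.generic_contDiffOn {n m : ℕ} (r : ℕ) {f : (Fin n → ℝ) → (Fin m → ℝ)} (hf : DF L f) :
    Generic fun O => ContDiffOn ℝ r f O := by
  intro O hOo hne
  obtain ⟨O1, h1, h2, h3, h4⟩ := Generic.forall_finite
    (fun i => (hf.apply i).generic_contDiffOn_real r)
    (fun i O O' h h' => h'.mono h) O hOo hne
  exact ⟨O1, h1, h2, h3, contDiffOn_pi.2 h4⟩

end Smooth

section Choice

/-- A canonical element of a nonempty tame set of reals that is bounded below. -/
noncomputable def pick (S : Set ℝ) : ℝ :=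
  open Classical in
  if sInf S ∈ S then sInf S
  else (sInf S + sSup {b | b ≤ sInf S + 1 ∧ ∀ t, sInf S < t → t < b → t ∈ S}) / 2

theorem pick_mem [hO : Fact (LocallyOMinimal L)] {S : Set ℝ} (hS : DP L (· ∈ S))
    (hne : S.Nonempty) (hb : BddBelow S) : pick S ∈ S := by
  by_cases h : sInf S ∈ S
  · rwa [pick, if_pos h]
  rw [pick, if_neg h]
  set m := sInf S
  set T := {b | b ≤ m + 1 ∧ ∀ t, m < t → t < b → t ∈ S}
  obtain ⟨b, hb', h1 | h1⟩ := hS.right_dichotomy m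
  · have hT : min b (m + 1) ∈ T :=
      ⟨min_le_right _ _, fun t ht ht' => h1 t ⟨ht, ht'.trans_le (min_le_left _ _)⟩⟩
    have hbdd : BddAbove T := ⟨m + 1, fun t ht => ht.1⟩
    have h2 : m < sSup T := (lt_min hb' (by linarith)).trans_le (le_csSup hbdd hT)
    obtain ⟨c, hc, hc'⟩ := exists_lt_of_lt_csSup ⟨_, hT⟩
      (show (m + sSup T) / 2 < sSup T by linarith)
    exact hc.2 _ (by linarith) hc'
  · exfalso
    have : b ≤ m := le_csInf hne fun s hs => by
      by_contra! hsb
      have hms : m ≤ s := csInf_le hb hs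
      rcases hms.eq_or_lt with hms | hms
      · exact h (hms ▸ hs)
      · exact h1 s ⟨hms, hsb⟩ hs
    exact absurd hb' (not_lt.2 this)

variable {E : Type} [Coord E] [hL : Fact (ExpandsOrderedField L)]

theorem DF.csSup {S : E → Set ℝ} (hS : DP L fun z : E × ℝ => z.2 ∈ S z.1) :
    DF L fun x => sSup (S x) := by
  have hS' : DP L fun z : (E × ℝ) × ℝ => z.2 ∈ S z.1.1 :=
    hS.comp (DF.fst'.fst.prodMk DF.snd')
  have hub : DP L fun z : E × ℝ => z.2 ∈ upperBounds (S z.1) :=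
    DP.forall (p := fun (z : E × ℝ) t => t ∈ S z.1 → t ≤ z.2) (hS'.imp (DP.le DF.snd' DF.fst'.snd))
  have hub' : DP L fun z : (E × ℝ) × ℝ => z.2 ∈ upperBounds (S z.1.1) :=
    hub.comp (DF.fst'.fst.prodMk DF.snd')
  have hlub : DP L fun z : E × ℝ => IsLUB (S z.1) z.2 :=
    hub.and (DP.forall (p := fun (z : E × ℝ) t => t ∈ upperBounds (S z.1) → z.2 ≤ t)
      (hub'.imp (DP.le DF.fst'.snd DF.snd')))
  refine DF.of_rel (p := fun x => ∃ y, IsLUB (S x) y) (R := fun x y => IsLUB (S x) y)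
    (DP.exists hlub) hlub 0 ?_ ?_
  · rintro x ⟨c, hc⟩ y
    rcases (S x).eq_empty_or_nonempty with h | h
    · rw [h] at hc
      exact absurd hc (by simp [isLUB_empty_iff, IsBot, not_forall, exists_lt])
    · constructor
      · rintro rfl
        exact isLUB_csSup h ⟨c, hc.1⟩
      · exact fun h' => (h'.csSup_eq h).symm
  · intro x hx
    rcases (S x).eq_empty_or_nonempty with h | h
    · simp [h]
    · exact Real.sSup_of_not_bddAbove fun h' => hx ⟨_, isLUB_csSup h h'⟩

theorem DF.csInf {S : E → Set ℝ} (hS : DP L fun z : E × ℝ => z.2 ∈ S z.1) :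
    DF L fun x => sInf (S x) := by
  have : DF L fun x => sSup (-(S x)) :=
    DF.csSup (hS.comp (DF.fst'.prodMk DF.snd'.neg))
  simpa only [Real.sInf_def] using this.neg

theorem DF.pick_comp {S : E → Set ℝ} (hS : DP L fun z : E × ℝ => z.2 ∈ S z.1) :
    DF L fun x => pick (S x) := by
  classical
  have hi : DF L fun x => sInf (S x) := DF.csInf hS
  refine DF.ite (hS.comp (DF.id.prodMk hi)) hi ((hi.add (DF.csSup ?_)).div (DF.const 2))
  refine (DP.le DF.snd' ((hi.comp DF.fst').add (DF.const 1))).and (DP.forall ?_)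
  refine (DP.lt (hi.comp DF.fst'.fst) DF.snd').imp ((DP.lt DF.snd' DF.fst'.snd).imp ?_)
  exact hS.comp (DF.fst'.fst.prodMk DF.snd')

variable [hO : Fact (LocallyOMinimal L)]

/-- Definable choice for families of bounded sets; the chosen point depends only on the fibre. -/
theorem exists_choice {n : ℕ} {R : E → (Fin n → ℝ) → Prop}
    (hR : DP L fun z : E × (Fin n → ℝ) => R z.1 z.2)
    (hb : ∀ x, ∃ M : ℝ, ∀ y, R x y → ∀ i, |y i| ≤ M) :
    ∃ s : E → Fin n → ℝ, DF L s ∧ (∀ x, (∃ y, R x y) → R x (s x)) ∧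
      ∀ x x', (∀ y, R x y ↔ R x' y) → s x = s x' := by
  induction n with
  | zero =>
    refine ⟨fun _ => 0, DF.const _, fun x ⟨y, hy⟩ => by rwa [Subsingleton.elim 0 y], by simp⟩
  | succ n ih =>
    have hcons : DF L fun z : ℝ × (Fin n → ℝ) => (Fin.cons z.1 z.2 : Fin (n + 1) → ℝ) :=
      DF.pi fun i => by
        induction i using Fin.cases with
        | zero => simpa only [Fin.cons_zero] using DF.fst'
        | succ i => simpa only [Fin.cons_succ] using DF.snd'.apply i
    let S : E → Set ℝ := fun x => {t | ∃ y, R x (Fin.cons t y : Fin (n + 1) → ℝ)}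
    have hS : DP L fun z : E × ℝ => z.2 ∈ S z.1 :=
      DP.exists (p := fun (z : E × ℝ) y => R z.1 (Fin.cons z.2 y : Fin (n + 1) → ℝ))
        (hR.comp (DF.fst'.fst.prodMk (hcons.comp (DF.fst'.snd.prodMk DF.snd'))))
    have hp : DF L fun x => pick (S x) := DF.pick_comp hS
    obtain ⟨s, hs1, hs2, hs3⟩ := ih
      (R := fun x y => R x (Fin.cons (pick (S x)) y : Fin (n + 1) → ℝ))
      (hR.comp (DF.fst'.prodMk (hcons.comp ((hp.comp DF.fst').prodMk DF.snd')))) (by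
        intro x
        obtain ⟨M, hM⟩ := hb x
        exact ⟨M, fun y hy i => by simpa using hM _ hy i.succ⟩)
    refine ⟨fun x => Fin.cons (pick (S x)) (s x), hcons.comp (hp.prodMk hs1), ?_, ?_⟩
    · rintro x ⟨y, hy⟩
      refine hs2 x ?_
      have : pick (S x) ∈ S x := by
        refine pick_mem (hS.comp ((DF.const x).prodMk DF.id)) ⟨y 0, Fin.tail y, by simpa⟩ ?_
        obtain ⟨M, hM⟩ := hb x
        refine ⟨-M, ?_⟩
        rintro t ⟨y, hy⟩
        exact neg_le_of_abs_le (by simpa using hM _ hy 0)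
      exact this
    · intro x x' h
      have hSS : S x = S x' := by
        ext t
        exact exists_congr fun y => h _
      have := hs3 x x' fun y => by rw [hSS]; exact h _
      simp only [hSS, this]

end Choice

section ConstantRank

/-- The selection of coordinates as a continuous linear map. -/
noncomputable def selectCLM {d m : ℕ} (p : Fin d → Fin m) : (Fin m → ℝ) →L[ℝ] (Fin d → ℝ) :=
  ContinuousLinearMap.pi fun i => ContinuousLinearMap.proj (p i)

@[simp]
theorem selectCLM_apply {d m : ℕ} (p : Fin d → Fin m) (x : Fin m → ℝ) (i : Fin d) :
    selectCLM p x i = x (p i) := rfl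

theorem exists_complement {n d e : ℕ} (hde : d + e = n) {A : (Fin n → ℝ) →L[ℝ] (Fin d → ℝ)}
    (hA : Function.Surjective A) : ∃ (Q : (Fin n → ℝ) →L[ℝ] (Fin e → ℝ))
      (T : (Fin n → ℝ) ≃L[ℝ] (Fin d → ℝ) × (Fin e → ℝ)), (T : _ →L[ℝ] _) = A.prod Q := by
  let A' : (Fin n → ℝ) →ₗ[ℝ] (Fin d → ℝ) := A
  have hk : Module.finrank ℝ A'.ker = e := by
    have h1 := A'.finrank_range_add_finrank_ker
    rw [LinearMap.range_eq_top.2 hA, finrank_top] at h1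
    simp only [Module.finrank_fin_fun] at h1
    omega
  obtain ⟨g, hg⟩ := A'.ker.subtype.exists_leftInverse_of_injective (by simp)
  let E : A'.ker ≃ₗ[ℝ] (Fin e → ℝ) := LinearEquiv.ofFinrankEq _ _ (by simp [hk])
  let Q : (Fin n → ℝ) →L[ℝ] (Fin e → ℝ) := LinearMap.toContinuousLinearMap (E.toLinearMap ∘ₗ g)
  have hinj : Function.Injective (A.prod Q : (Fin n → ℝ) →ₗ[ℝ] (Fin d → ℝ) × (Fin e → ℝ)) := by
    rw [← LinearMap.ker_eq_bot, LinearMap.ker_eq_bot']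
    intro x hx
    have h1 : A x = 0 := congrArg Prod.fst hx
    have h2 : E (g x) = 0 := congrArg Prod.snd hx
    have h3 : g x = ⟨x, h1⟩ := LinearMap.congr_fun hg ⟨x, h1⟩
    rw [h3] at h2
    simpa using congrArg Subtype.val (E.map_eq_zero_iff.1 h2)
  refine ⟨Q, (LinearEquiv.ofInjectiveOfFinrankEq _ hinj (by simp [hde])).toContinuousLinearEquiv,
    ?_⟩
  ext x <;> rfl

/-- The local normal form of a map near a point of maximal rank. -/
theorem exists_constant_rank {n m r : ℕ} (hr : r ≠ 0) {F : (Fin n → ℝ) → (Fin m → ℝ)}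
    {O : Set (Fin n → ℝ)} (hOo : IsOpen O) (hne : O.Nonempty) (hF : ContDiffOn ℝ r F O) :
    ∃ (d e : ℕ) (p : Fin d → Fin m) (Q : (Fin n → ℝ) →L[ℝ] (Fin e → ℝ)) (x₀ : Fin n → ℝ)
      (y₀ : Fin d → ℝ) (z₀ : Fin e → ℝ) (δ ε : ℝ) (κ : (Fin d → ℝ) × (Fin e → ℝ) → (Fin n → ℝ)),
      d + e = n ∧ Function.Injective p ∧ 0 < δ ∧ 0 < ε ∧ Metric.ball x₀ δ ⊆ O ∧
      ContDiffOn ℝ r κ (Metric.ball y₀ ε ×ˢ Metric.ball z₀ ε) ∧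
      (∀ y ∈ Metric.ball y₀ ε, ∀ z ∈ Metric.ball z₀ ε,
        κ (y, z) ∈ Metric.ball x₀ δ ∧ (fun i => F (κ (y, z)) (p i)) = y ∧ Q (κ (y, z)) = z ∧
        F (κ (y, z)) = F (κ (y, z₀))) ∧
      (∀ x ∈ Metric.ball x₀ δ, (fun i => F x (p i)) ∈ Metric.ball y₀ ε →
        Q x ∈ Metric.ball z₀ ε → κ (fun i => F x (p i), Q x) = x) := by
  classical
  let P : ℕ → Prop := fun d => ∃ x ∈ O, ∃ p : Fin d → Fin m,
    Function.Surjective ((selectCLM p).comp (fderiv ℝ F x))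
  have hP0 : P 0 := by
    obtain ⟨x, hx⟩ := hne
    exact ⟨x, hx, Fin.elim0, fun y => ⟨0, Subsingleton.elim _ _⟩⟩
  have hPn : ∀ d, P d → d ≤ n := by
    rintro d ⟨x, -, p, h⟩
    simpa using LinearMap.finrank_le_finrank_of_surjective
      (f := ((selectCLM p).comp (fderiv ℝ F x) : (Fin n → ℝ) →ₗ[ℝ] (Fin d → ℝ))) h
  obtain ⟨d, hPd, hmax⟩ : ∃ d, P d ∧ ¬ P (d + 1) := by
    refine ⟨Nat.findGreatest P n, Nat.findGreatest_spec (Nat.zero_le n) hP0, fun h => ?_⟩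
    exact Nat.findGreatest_is_greatest (Nat.lt_succ_self _) (hPn _ h) h
  obtain ⟨e, hde⟩ := Nat.exists_eq_add_of_le (hPn d hPd)
  obtain ⟨x₀, hx₀, p, hp⟩ := hPd
  have hpinj : Function.Injective p := by
    intro i j hij
    obtain ⟨v, hv⟩ := hp (Pi.single i 1)
    by_contra h
    have h1 := congrFun hv i
    have h2 := congrFun hv j
    simp only [ContinuousLinearMap.coe_comp, Function.comp_apply, selectCLM_apply] at h1 h2
    rw [hij, h2] at h1
    simp [Ne.symm h] at h1
  obtain ⟨Q, T, hT⟩ := exists_complement hde.symm hp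
  have hr1 : (r : WithTop ℕ∞) ≠ 0 := by exact_mod_cast hr
  have hFd : ∀ x ∈ O, HasFDerivAt F (fderiv ℝ F x) x := fun x hx =>
    ((hF.contDiffAt (hOo.mem_nhds hx)).differentiableAt hr1).hasFDerivAt
  let Θ : (Fin n → ℝ) → (Fin d → ℝ) × (Fin e → ℝ) := fun x => (selectCLM p (F x), Q x)
  have hΘ : ContDiffAt ℝ r Θ x₀ :=
    ((selectCLM p).contDiff.contDiffAt.comp x₀ (hF.contDiffAt (hOo.mem_nhds hx₀))).prodMk
      Q.contDiff.contDiffAt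
  have hΘ' : HasFDerivAt Θ (T : _ →L[ℝ] _) x₀ := by
    rw [hT]
    exact (((selectCLM p).hasFDerivAt).comp x₀ (hFd x₀ hx₀)).prodMk Q.hasFDerivAt
  let Φ := hΘ.toOpenPartialHomeomorph Θ hΘ' hr1
  have hΦ : ∀ x, Φ x = Θ x := fun x => rfl
  have hx₀s : x₀ ∈ Φ.source := hΘ.mem_toOpenPartialHomeomorph_source hΘ' hr1
  have hsymm : ContDiffAt ℝ r Φ.symm (Θ x₀) := hΘ.to_localInverse hΘ' hr1
  obtain ⟨u, hu, -, hu'⟩ := ContDiffWithinAt.contDiffOn le_rfl (by simp) hsymm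
  rw [insert_eq_of_mem (mem_univ _), nhdsWithin_univ] at hu
  obtain ⟨δ, hδ, hδ'⟩ := Metric.isOpen_iff.1 (hOo.inter Φ.open_source) x₀ ⟨hx₀, hx₀s⟩
  have hu : ∀ᶠ w in 𝓝 (Θ x₀), w ∈ u := hu
  have ht : ∀ᶠ w in 𝓝 (Θ x₀), w ∈ Φ.target := Φ.open_target.mem_nhds (Φ.map_source hx₀s)
  have hev : ∀ᶠ w in 𝓝 (Θ x₀), w ∈ u ∧ w ∈ Φ.target ∧ Φ.symm w ∈ Metric.ball x₀ δ := by
    refine hu.and (ht.and (hsymm.continuousAt.eventually ?_))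
    have : Φ.symm (Θ x₀) = x₀ := Φ.left_inv hx₀s
    rw [this]
    exact Metric.ball_mem_nhds _ hδ
  obtain ⟨ε, hε, hε'⟩ := Metric.eventually_nhds_iff_ball.1 hev
  have hbox : Metric.ball (Θ x₀).1 ε ×ˢ Metric.ball (Θ x₀).2 ε = Metric.ball (Θ x₀) ε :=
    ball_prod_same _ _ _
  have hright : ∀ w ∈ Metric.ball (Θ x₀) ε, Θ (Φ.symm w) = w := fun w hw =>
    Φ.right_inv (hε' w hw).2.1
  have hκ : ContDiffOn ℝ r Φ.symm (Metric.ball (Θ x₀) ε) := hu'.mono fun w hw => (hε' w hw).1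
  have hconst : ∀ w ∈ Metric.ball (Θ x₀) ε, HasFDerivAt (fun z => F (Φ.symm (w.1, z)))
      (0 : (Fin e → ℝ) →L[ℝ] (Fin m → ℝ)) w.2 := by
    intro w hw
    have hK : HasFDerivAt Φ.symm (fderiv ℝ Φ.symm w) w :=
      ((hκ.contDiffAt (Metric.isOpen_ball.mem_nhds hw)).differentiableAt hr1).hasFDerivAt
    set K := fderiv ℝ Φ.symm w
    set x := Φ.symm w
    have hxO : x ∈ O := (hδ' (hε' w hw).2.2).1
    have hFK : HasFDerivAt (fun w => F (Φ.symm w)) ((fderiv ℝ F x).comp K) w :=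
      (hFd x hxO).comp w hK
    have h1 : (selectCLM p).comp ((fderiv ℝ F x).comp K) = ContinuousLinearMap.fst ℝ _ _ := by
      refine HasFDerivAt.unique (((selectCLM p).hasFDerivAt).comp w hFK)
        (hasFDerivAt_fst.congr_of_eventuallyEq ?_)
      filter_upwards [Metric.isOpen_ball.mem_nhds hw] with w' hw'
      exact congrArg Prod.fst (hright w' hw')
    have h2 : ∀ v, selectCLM p (fderiv ℝ F x v) = 0 → fderiv ℝ F x v = 0 := by
      intro v hv
      by_contra hne
      obtain ⟨j, hj⟩ := Function.ne_iff.1 hne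
      refine hmax ⟨x, hxO, Fin.cons j p, fun t => ?_⟩
      let v₁ := K (Fin.tail t, 0)
      have hv₁ : ∀ i, fderiv ℝ F x v₁ (p i) = t i.succ := fun i =>
        congrFun (DFunLike.congr_fun h1 (Fin.tail t, 0)) i
      have hv' : ∀ i, fderiv ℝ F x v (p i) = 0 := fun i => congrFun hv i
      refine ⟨v₁ + ((t 0 - fderiv ℝ F x v₁ j) / fderiv ℝ F x v j) • v, ?_⟩
      have hj' : fderiv ℝ F x v j ≠ 0 := hj
      ext i
      induction i using Fin.cases with
      | zero => simp [hj']
      | succ i => simp [hv₁, hv']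
    have h3 : ((fderiv ℝ F x).comp K).comp (ContinuousLinearMap.inr ℝ (Fin d → ℝ) (Fin e → ℝ)) =
        0 := by
      ext1 v
      refine h2 _ ?_
      exact DFunLike.congr_fun h1 (0, v)
    rw [← h3]
    have h4 : HasFDerivAt (fun z : Fin e → ℝ => (w.1, z)) (ContinuousLinearMap.inr ℝ _ _) w.2 :=
      hasFDerivAt_prodMk_right _ _
    exact HasFDerivAt.comp (g := fun w => F (Φ.symm w)) w.2 hFK h4
  refine ⟨d, e, p, Q, x₀, (Θ x₀).1, (Θ x₀).2, δ, ε, Φ.symm, hde.symm, hpinj, hδ, hε,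
    fun x hx => (hδ' hx).1, by rwa [hbox], ?_, ?_⟩
  · intro y hy z hz
    have hw : (y, z) ∈ Metric.ball (Θ x₀) ε := hbox ▸ mk_mem_prod hy hz
    refine ⟨(hε' _ hw).2.2, congrArg Prod.fst (hright _ hw), congrArg Prod.snd (hright _ hw), ?_⟩
    have := (convex_ball (Θ x₀).2 ε).norm_image_sub_le_of_norm_hasFDerivWithin_le
      (f := fun z => F (Φ.symm (y, z))) (f' := fun _ => 0) (C := 0) (x := (Θ x₀).2) (y := z)
      (fun z' hz' => (hconst (y, z') (hbox ▸ mk_mem_prod hy hz')).hasFDerivWithinAt)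
      (by simp) (Metric.mem_ball_self hε) hz
    simpa [sub_eq_zero] using this
  · intro x hx _ _
    exact Φ.left_inv (hδ' hx).2

end ConstantRank

section NormalForm

variable (L) in
/-- A definable local normal form of `F` inside `O`: on the box parametrised by `κ`, the map `F`
depends only on the coordinates selected by `p`. -/
structure NormalForm (r : ℕ) {n m : ℕ} (F : (Fin n → ℝ) → (Fin m → ℝ)) (O : Set (Fin n → ℝ)) where
  d : ℕ
  e : ℕ
  p : Fin d → Fin m
  Q : (Fin n → ℝ) →L[ℝ] (Fin e → ℝ)
  x₀ : Fin n → ℝ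
  y₀ : Fin d → ℝ
  z₀ : Fin e → ℝ
  δ : ℝ
  ε : ℝ
  κ : (Fin d → ℝ) × (Fin e → ℝ) → (Fin n → ℝ)
  d_add_e : d + e = n
  p_injective : Function.Injective p
  δ_pos : 0 < δ
  ε_pos : 0 < ε
  ball_subset : Metric.ball x₀ δ ⊆ O
  contDiffOn_F : ContDiffOn ℝ r F (Metric.ball x₀ δ)
  definable_κ : DF L κ
  contDiffOn_κ : ContDiffOn ℝ r κ (Metric.ball y₀ ε ×ˢ Metric.ball z₀ ε)
  κ_mem : ∀ y ∈ Metric.ball y₀ ε, ∀ z ∈ Metric.ball z₀ ε, κ (y, z) ∈ Metric.ball x₀ δ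
  F_κ : ∀ y ∈ Metric.ball y₀ ε, ∀ z ∈ Metric.ball z₀ ε, (fun i => F (κ (y, z)) (p i)) = y
  Q_κ : ∀ y ∈ Metric.ball y₀ ε, ∀ z ∈ Metric.ball z₀ ε, Q (κ (y, z)) = z
  F_const : ∀ y ∈ Metric.ball y₀ ε, ∀ z ∈ Metric.ball z₀ ε, F (κ (y, z)) = F (κ (y, z₀))
  κ_left : ∀ x ∈ Metric.ball x₀ δ, (fun i => F x (p i)) ∈ Metric.ball y₀ ε →
    Q x ∈ Metric.ball z₀ ε → κ (fun i => F x (p i), Q x) = x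

variable {E : Type} [Coord E] [hL : Fact (ExpandsOrderedField L)]

theorem DP.mem_ball {n : ℕ} {f : E → Fin n → ℝ} (hf : DF L f) (a : Fin n → ℝ) (ε : ℝ) :
    DP L fun x => f x ∈ Metric.ball a ε :=
  DP.dist_lt hf (DF.const a) (DF.const ε)

variable [hO : Fact (LocallyOMinimal L)]

theorem DF.exists_normalForm (r : ℕ) {n m : ℕ} {F : (Fin n → ℝ) → (Fin m → ℝ)} (hF : DF L F)
    {O : Set (Fin n → ℝ)} (hOo : IsOpen O) (hne : O.Nonempty) :
    Nonempty (NormalForm L r F O) := by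
  classical
  obtain ⟨O1, h1, h2, h3, h4⟩ := hF.generic_contDiffOn (r + 1) O hOo hne
  obtain ⟨d, e, p, Q, x₀, y₀, z₀, δ, ε, κ, hde, hp, hδ, hε, hball, hκ, hκ', hκl⟩ :=
    exists_constant_rank (Nat.succ_ne_zero r) h2 h3 h4
  let κ' : (Fin d → ℝ) × (Fin e → ℝ) → (Fin n → ℝ) := fun w =>
    if w.1 ∈ Metric.ball y₀ ε ∧ w.2 ∈ Metric.ball z₀ ε then κ w else 0
  have hκκ : ∀ y ∈ Metric.ball y₀ ε, ∀ z ∈ Metric.ball z₀ ε, κ' (y, z) = κ (y, z) :=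
    fun y hy z hz => if_pos ⟨hy, hz⟩
  have hDF : DF L κ' := by
    refine DF.of_rel
      (p := fun w : (Fin d → ℝ) × (Fin e → ℝ) => w.1 ∈ Metric.ball y₀ ε ∧ w.2 ∈ Metric.ball z₀ ε)
      (R := fun w x => (x ∈ Metric.ball x₀ δ ∧ (fun i => F x (p i)) = w.1) ∧ Q x = w.2)
      ((DP.mem_ball DF.fst' _ _).and (DP.mem_ball DF.snd' _ _))
      (((DP.mem_ball DF.snd' _ _).and (DP.eq (DF.pi fun i => ?_) DF.fst'.fst)).and
        (DP.eq ((DF.clm Q).comp DF.snd') DF.fst'.snd)) 0 ?_ ?_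
    · exact (hF.comp DF.snd').apply (p i)
    · rintro ⟨y, z⟩ ⟨hy, hz⟩ x
      rw [hκκ y hy z hz]
      obtain ⟨k1, k2, k3, -⟩ := hκ' y hy z hz
      constructor
      · rintro rfl
        exact ⟨⟨k1, k2⟩, k3⟩
      · rintro ⟨⟨hx1, hx2⟩, hx3⟩
        dsimp only at hx2 hx3
        subst hx2 hx3
        exact (hκl x hx1 hy hz).symm
    · exact fun w hw => if_neg hw
  have hr : (r : WithTop ℕ∞) ≤ ((r + 1 : ℕ) : WithTop ℕ∞) := by exact_mod_cast Nat.le_succ r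
  exact ⟨{ d, e, p, Q, x₀, y₀, z₀, δ, ε
           κ := κ'
           d_add_e := hde
           p_injective := hp
           δ_pos := hδ
           ε_pos := hε
           ball_subset := hball.trans h1
           contDiffOn_F := (h4.mono hball).of_le hr
           definable_κ := hDF
           contDiffOn_κ := (hκ.of_le hr).congr fun w hw => hκκ w.1 hw.1 w.2 hw.2
           κ_mem := fun y hy z hz => by rw [hκκ y hy z hz]; exact (hκ' y hy z hz).1
           F_κ := fun y hy z hz => by rw [hκκ y hy z hz]; exact (hκ' y hy z hz).2.1
           Q_κ := fun y hy z hz => by rw [hκκ y hy z hz]; exact (hκ' y hy z hz).2.2.1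
           F_const := fun y hy z hz => by
            rw [hκκ y hy z hz, hκκ y hy z₀ (Metric.mem_ball_self hε)]
            exact (hκ' y hy z hz).2.2.2
           κ_left := fun x hx hy hz => by rw [hκκ _ hy _ hz]; exact hκl x hx hy hz }⟩

theorem exists_interior_coordProj_image {e m : ℕ} {F : (Fin e → ℝ) → (Fin m → ℝ)} (hF : DF L F)
    {O : Set (Fin e → ℝ)} (hOo : IsOpen O) (hne : O.Nonempty) (hinj : InjOn F O) :
    ∃ p : Fin e → Fin m, Function.Injective p ∧
      (interior (coordProj e p '' (F '' O))).Nonempty := by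
  obtain ⟨S⟩ := hF.exists_normalForm 0 hOo hne
  have hz₀ := Metric.mem_ball_self (x := S.z₀) S.ε_pos
  have hy₀ := Metric.mem_ball_self (x := S.y₀) S.ε_pos
  have he : S.e = 0 := by
    by_contra h
    let z : Fin S.e → ℝ := fun i => S.z₀ i + S.ε / 2
    have hz : z ∈ Metric.ball S.z₀ S.ε := by
      rw [Metric.mem_ball, dist_pi_lt_iff S.ε_pos]
      intro i
      simp only [z, Real.dist_eq, add_sub_cancel_left]
      rw [abs_of_pos (half_pos S.ε_pos)]
      exact half_lt_self S.ε_pos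
    have h1 := hinj (S.ball_subset (S.κ_mem _ hy₀ z hz)) (S.ball_subset (S.κ_mem _ hy₀ _ hz₀))
      (S.F_const _ hy₀ z hz)
    have h2 := congrArg S.Q h1
    rw [S.Q_κ _ hy₀ _ hz, S.Q_κ _ hy₀ _ hz₀] at h2
    have := congrFun h2 ⟨0, Nat.pos_of_ne_zero h⟩
    simp only [z] at this
    linarith [S.ε_pos]
  have hd : S.d = e := by have := S.d_add_e; omega
  have key : ∃ p : Fin S.d → Fin m, Function.Injective p ∧
      (interior (coordProj S.d p '' (F '' O))).Nonempty := by
    refine ⟨S.p, S.p_injective, S.y₀, ?_⟩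
    refine mem_interior.2 ⟨Metric.ball S.y₀ S.ε, fun y hy => ?_, Metric.isOpen_ball, hy₀⟩
    exact ⟨_, ⟨_, S.ball_subset (S.κ_mem y hy _ hz₀), rfl⟩, S.F_κ y hy _ hz₀⟩
  rwa [hd] at key

theorem le_of_injOn {e m : ℕ} {F : (Fin e → ℝ) → (Fin m → ℝ)} (hF : DF L F)
    {O : Set (Fin e → ℝ)} (hOo : IsOpen O) (hne : O.Nonempty) (hinj : InjOn F O) : e ≤ m := by
  obtain ⟨p, hp, -⟩ := exists_interior_coordProj_image hF hOo hne hinj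
  simpa using Fintype.card_le_of_injective p hp

/-- A bounded definable set that locally injects definably into `ℝᵐ` has dimension at most
`m`. -/
theorem le_of_locally_injOn {n m : ℕ} {S : Set (Fin n → ℝ)} (hS : DP L (· ∈ S))
    (hb : Bornology.IsBounded S)
    (hloc : ∀ a ∈ S, ∃ U ∈ 𝓝 a, ∃ χ : (Fin n → ℝ) → (Fin m → ℝ), DF L χ ∧ InjOn χ (S ∩ U))
    {e : ℕ} (σ : Fin e → Fin n) (h : (interior (coordProj e σ '' S)).Nonempty) : e ≤ m := by
  obtain ⟨M, hM⟩ := hb.exists_norm_le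
  obtain ⟨s, hs, hs', -⟩ := exists_choice (L := L) (E := Fin e → ℝ)
    (R := fun y x => x ∈ S ∧ coordProj e σ x = y)
    ((hS.comp DF.snd').and (DP.eq (DF.pi fun i => DF.snd'.apply (σ i)) DF.fst'))
    (fun y => ⟨M, fun x hx i => (norm_le_pi_norm x i).trans (hM x hx.1)⟩)
  have hs2 : ∀ y ∈ interior (coordProj e σ '' S), s y ∈ S ∧ coordProj e σ (s y) = y := by
    intro y hy
    obtain ⟨x, hx, hxy⟩ := interior_subset hy
    exact hs' y ⟨x, hx, hxy⟩
  obtain ⟨O1, h1, h2, ⟨y, hy⟩, h4⟩ := hs.generic_continuousOn _ isOpen_interior h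
  obtain ⟨U, hU, χ, hχ, hinj⟩ := hloc (s y) (hs2 y (h1 hy)).1
  have h5 : ∀ᶠ y' in 𝓝 y, s y' ∈ U := (h4.continuousAt (h2.mem_nhds hy)).eventually hU
  obtain ⟨O2, hO2, hO2o, hyO2⟩ := eventually_nhds_iff.1 (h5.and (h2.mem_nhds hy))
  refine le_of_injOn (hχ.comp hs) hO2o ⟨y, hyO2⟩ fun y₁ hy₁ y₂ hy₂ h12 => ?_
  have k1 := hs2 _ (h1 (hO2 _ hy₁).2)
  have k2 := hs2 _ (h1 (hO2 _ hy₂).2)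
  have := hinj ⟨k1.1, (hO2 _ hy₁).1⟩ ⟨k2.1, (hO2 _ hy₂).1⟩ h12
  rw [← k1.2, ← k2.2, this]

end NormalForm

section CrOn

variable {E F F' : Type*} [NormedAddCommGroup E] [NormedSpace ℝ E] [NormedAddCommGroup F]
  [NormedSpace ℝ F] [NormedAddCommGroup F'] [NormedSpace ℝ F']

/-- `f` locally extends from `X` to a `C^r` map on an open set of the ambient space. -/
def CrOn (r : ℕ) (f : E → F) (X : Set E) : Prop :=
  ∀ a ∈ X, ∃ (W : Set E) (g : E → F), a ∈ W ∧ IsOpen W ∧ ContDiffOn ℝ r g W ∧ EqOn f g (X ∩ W)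

variable {r : ℕ}

theorem ContDiffOn.crOn {f : E → F} {X : Set E} (hf : ContDiffOn ℝ r f X) (hX : IsOpen X) :
    CrOn r f X :=
  fun _ ha => ⟨X, f, ha, hX, hf, fun _ _ => rfl⟩

theorem ContDiff.crOn {f : E → F} (X : Set E) (hf : ContDiff ℝ r f) : CrOn r f X :=
  fun a _ => ⟨univ, f, mem_univ a, isOpen_univ, hf.contDiffOn, fun _ _ => rfl⟩

theorem CrOn.contDiffOn {f : E → F} {X : Set E} (hf : CrOn r f X) : ContDiffOn ℝ r f X := by
  intro a ha
  obtain ⟨W, g, haW, hW, hg, hfg⟩ := hf a ha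
  have h1 : ContDiffWithinAt ℝ r g X a := (hg.contDiffAt (hW.mem_nhds haW)).contDiffWithinAt
  refine h1.congr_of_eventuallyEq ?_ (hfg ⟨ha, haW⟩)
  filter_upwards [inter_mem_nhdsWithin X (hW.mem_nhds haW)] with x hx using hfg hx

theorem CrOn.continuousOn {f : E → F} {X : Set E} (hf : CrOn r f X) : ContinuousOn f X :=
  hf.contDiffOn.continuousOn

theorem CrOn.congr {f g : E → F} {X : Set E} (hf : CrOn r f X) (h : EqOn g f X) : CrOn r g X :=
  fun a ha => by
    obtain ⟨W, f', haW, hW, hf', hff'⟩ := hf a ha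
    exact ⟨W, f', haW, hW, hf', fun x hx => (h hx.1).trans (hff' hx)⟩

theorem CrOn.mono {f : E → F} {X Y : Set E} (hf : CrOn r f X) (h : Y ⊆ X) : CrOn r f Y :=
  fun a ha => by
    obtain ⟨W, f', haW, hW, hf', hff'⟩ := hf a (h ha)
    exact ⟨W, f', haW, hW, hf', fun x hx => hff' ⟨h hx.1, hx.2⟩⟩

theorem CrOn.comp {g : F → F'} {f : E → F} {X : Set E} {Y : Set F} (hg : CrOn r g Y)
    (hf : CrOn r f X) (h : MapsTo f X Y) : CrOn r (fun x => g (f x)) X := by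
  intro a ha
  obtain ⟨W, f', haW, hW, hf', hff'⟩ := hf a ha
  obtain ⟨W', g', haW', hW', hg', hgg'⟩ := hg (f a) (h ha)
  refine ⟨W ∩ f' ⁻¹' W', g' ∘ f', ⟨haW, ?_⟩, hf'.continuousOn.isOpen_inter_preimage hW hW',
    hg'.comp (hf'.mono inter_subset_left) fun x hx => hx.2, ?_⟩
  · rwa [mem_preimage, ← hff' ⟨ha, haW⟩]
  · rintro x ⟨hx, hxW, hxW'⟩
    have h1 : f x = f' x := hff' ⟨hx, hxW⟩
    rw [Function.comp_apply, ← h1]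
    exact hgg' ⟨h hx, by rw [h1]; exact hxW'⟩

theorem CrOn.prodMk {f : E → F} {g : E → F'} {X : Set E} (hf : CrOn r f X) (hg : CrOn r g X) :
    CrOn r (fun x => (f x, g x)) X := by
  intro a ha
  obtain ⟨W, f', haW, hW, hf', hff'⟩ := hf a ha
  obtain ⟨W', g', haW', hW', hg', hgg'⟩ := hg a ha
  exact ⟨W ∩ W', fun x => (f' x, g' x), ⟨haW, haW'⟩, hW.inter hW',
    (hf'.mono inter_subset_left).prodMk (hg'.mono inter_subset_right),
    fun x hx => Prod.ext (hff' ⟨hx.1, hx.2.1⟩) (hgg' ⟨hx.1, hx.2.2⟩)⟩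

theorem CrOn.pi {ι : Type*} [Fintype ι] {f : E → ι → ℝ} {X : Set E}
    (hf : ∀ i, CrOn r (fun x => f x i) X) : CrOn r f X := by
  intro a ha
  choose W g haW hW hg hfg using fun i => hf i a ha
  exact ⟨⋂ i, W i, fun x i => g i x, mem_iInter.2 haW, isOpen_iInter_of_finite hW,
    contDiffOn_pi.2 fun i => (hg i).mono (iInter_subset _ i),
    fun x hx => funext fun i => hfg i ⟨hx.1, mem_iInter.1 hx.2 i⟩⟩

theorem CrOn.of_locally {f : E → F} {X : Set E}
    (h : ∀ a ∈ X, ∃ W, IsOpen W ∧ a ∈ W ∧ CrOn r f (X ∩ W)) : CrOn r f X := by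
  intro a ha
  obtain ⟨W, hW, haW, hf⟩ := h a ha
  obtain ⟨W', g, haW', hW', hg, hfg⟩ := hf a ⟨ha, haW⟩
  exact ⟨W ∩ W', g, ⟨haW, haW'⟩, hW.inter hW', hg.mono inter_subset_right,
    fun x hx => hfg ⟨⟨hx.1, hx.2.1⟩, hx.2.2⟩⟩

theorem CrOn.clm_comp (A : F →L[ℝ] F') {f : E → F} {X : Set E} (hf : CrOn r f X) :
    CrOn r (fun x => A (f x)) X :=
  (ContDiff.crOn univ A.contDiff).comp hf (mapsTo_univ _ _)

end CrOn

section Submanifold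

theorem exists_perm_extending {d k : ℕ} {τ : Fin d → Fin k} (hτ : Function.Injective τ) :
    ∃ π : Equiv.Perm (Fin k), ∀ (i : Fin k) (hi : (i : ℕ) < d), π i = τ ⟨i, hi⟩ := by
  classical
  have hdk : d ≤ k := by simpa using Fintype.card_le_of_injective τ hτ
  let e₁ : {i : Fin k // (i : ℕ) < d} ≃ Fin d :=
    { toFun := fun i => ⟨i.1, i.2⟩
      invFun := fun j => ⟨⟨j, j.2.trans_le hdk⟩, j.2⟩
      left_inv := fun _ => rfl
      right_inv := fun _ => rfl }
  let e₂ := e₁.trans (Equiv.ofInjective τ hτ)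
  exact ⟨e₂.extendSubtype, fun i hi => e₂.extendSubtype_apply_of_mem i hi⟩

variable [hL : Fact (ExpandsOrderedField L)]

/-- A definable set that is locally the graph of a definable `C^r` map over `d` of the
coordinates is a definable `C^r` submanifold of dimension `d`. -/
theorem isDefCrSubmanifold_of_graph {r k d : ℕ} {X : Set (Fin k → ℝ)} (hX : DP L (· ∈ X))
    (h : ∀ a ∈ X, ∃ (τ : Fin d → Fin k) (U : Set (Fin k → ℝ)) (D : Set (Fin d → ℝ))
      (v : (Fin d → ℝ) → (Fin k → ℝ)), Function.Injective τ ∧ a ∈ U ∧ IsOpen U ∧ DP L (· ∈ U) ∧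
      IsOpen D ∧ DP L (· ∈ D) ∧ DF L v ∧ ContDiffOn ℝ r v D ∧ (∀ x ∈ U, coordProj d τ x ∈ D) ∧
      (∀ y ∈ D, coordProj d τ (v y) = y) ∧ ∀ x ∈ U, (x ∈ X ↔ x = v (coordProj d τ x))) :
    IsDefCrSubmanifold L r k d X := by
  classical
  refine ⟨hX, fun a ha => ?_⟩
  obtain ⟨τ, U, D, v, hτ, haU, hU, hUd, hD, hDd, hv, hvr, hUD, hvτ, hUX⟩ := h a ha
  obtain ⟨π, hπ⟩ := exists_perm_extending hτ
  have hdk : d ≤ k := by simpa using Fintype.card_le_of_injective τ hτ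
  let φ : (Fin k → ℝ) → (Fin k → ℝ) := fun x i =>
    x (π i) - (if (i : ℕ) < d then a (π i) else v (coordProj d τ x) (π i))
  let Y : (Fin k → ℝ) → (Fin d → ℝ) := fun z j => z ⟨j, j.2.trans_le hdk⟩ + a (τ j)
  let ψ : (Fin k → ℝ) → (Fin k → ℝ) := fun z i =>
    z (π.symm i) + (if ((π.symm i : Fin k) : ℕ) < d then a i else v (Y z) i)
  have hτπ : ∀ j : Fin d, π ⟨j, j.2.trans_le hdk⟩ = τ j := fun j => hπ _ j.2
  have hYφ : ∀ x, Y (φ x) = coordProj d τ x := fun x => funext fun j => by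
    simp [Y, φ, hτπ, coordProj]
  have hτψ : ∀ z, coordProj d τ (ψ z) = Y z := fun z => funext fun j => by
    have : π.symm (τ j) = ⟨j, j.2.trans_le hdk⟩ := by rw [← hτπ, Equiv.symm_apply_apply]
    simp [Y, ψ, coordProj, this]
  have hψφ : ∀ x, ψ (φ x) = x := fun x => funext fun i => by
    simp only [ψ, hYφ]
    simp [φ]
  have hφψ : ∀ z, φ (ψ z) = z := fun z => funext fun i => by
    simp only [φ, hτψ]
    simp [ψ]
  have hYc : ContDiff ℝ r Y := contDiff_pi.2 fun j => (contDiff_apply _ _ _).add contDiff_const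
  have hφc : ContDiffOn ℝ r φ U := by
    refine contDiffOn_pi.2 fun i => (contDiff_apply _ _ _).contDiffOn.sub ?_
    split_ifs
    · exact contDiffOn_const
    · refine (contDiffOn_pi.1 hvr (π i)).comp (ContDiff.contDiffOn ?_) fun x hx => hUD x hx
      exact contDiff_pi.2 fun j => contDiff_apply _ _ _
  have hψc : ContDiffOn ℝ r ψ (Y ⁻¹' D) := by
    refine contDiffOn_pi.2 fun i => (contDiff_apply _ _ _).contDiffOn.add ?_
    split_ifs
    · exact contDiffOn_const
    · exact (contDiffOn_pi.1 hvr i).comp hYc.contDiffOn fun x hx => hx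
  have hYd : DF L Y := DF.pi fun j => (DF.eval _).add (DF.const _)
  have hφd : DF L φ := DF.pi fun i => by
    refine (DF.eval _).sub ?_
    split_ifs
    · exact DF.const _
    · exact (hv.comp (DF.pi fun j => DF.eval _)).apply _
  have hψd : DF L ψ := DF.pi fun i => by
    refine (DF.eval _).add ?_
    split_ifs
    · exact DF.const _
    · exact (hv.comp hYd).apply _
  have hav : a = v (coordProj d τ a) := (hUX a haU).1 ha
  have hφa : φ a = 0 := funext fun i => by
    simp only [φ, ← hav]
    simp
  let V := Y ⁻¹' D ∩ ψ ⁻¹' U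
  have hφV : MapsTo φ U V := fun x hx =>
    ⟨by rw [mem_preimage, hYφ]; exact hUD x hx, by rwa [mem_preimage, hψφ]⟩
  have hψU : MapsTo ψ V U := fun z hz => hz.2
  have hVd : DP L (· ∈ V) := (hDd.comp hYd).and (hUd.comp hψd)
  have hinv : InvOn ψ φ U V := ⟨fun x _ => hψφ x, fun z _ => hφψ z⟩
  refine ⟨U, V, φ, ψ, haU, hU, hUd, hφa ▸ hφV haU,
    hψc.continuousOn.isOpen_inter_preimage (hD.preimage hYc.continuous) hU, hVd,
    DefMapOn.of_DF hUd hφd, DefMapOn.of_DF hVd hψd, hφc, hψc.mono inter_subset_left,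
    hinv.bijOn hφV hψU, hinv, hφa, ?_⟩
  ext z
  constructor
  · rintro ⟨x, ⟨hxX, hxU⟩, rfl⟩
    refine ⟨hφV hxU, fun i hi => ?_⟩
    simp only [φ, if_neg (not_lt.2 hi), ← (hUX x hxU).1 hxX, sub_self]
  · rintro ⟨hz, hz0⟩
    refine ⟨ψ z, ⟨(hUX _ (hψU hz)).2 ?_, hψU hz⟩, hφψ z⟩
    rw [hτψ]
    ext i
    by_cases hi : ((π.symm i : Fin k) : ℕ) < d
    · obtain ⟨j, rfl⟩ : ∃ j, τ j = i := ⟨⟨_, hi⟩, by rw [← hπ, Equiv.apply_symm_apply]⟩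
      have h1 := congrFun (hτψ z) j
      have h2 := congrFun (hvτ _ hz.1) j
      exact h1.trans h2.symm
    · simp only [ψ, if_neg hi, hz0 _ (not_lt.1 hi), zero_add]

end Submanifold

section Bump

theorem hasDerivAt_max_zero_pow (k : ℕ) (s : ℝ) :
    HasDerivAt (fun s : ℝ => max 0 s ^ (k + 2)) ((k + 2) * max 0 s ^ (k + 1)) s := by
  rcases lt_trichotomy s 0 with h | rfl | h
  · have h1 : HasDerivAt (fun _ : ℝ => (0 : ℝ)) 0 s := hasDerivAt_const _ _
    rw [max_eq_left h.le, zero_pow (Nat.succ_ne_zero k), mul_zero]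
    refine h1.congr_of_eventuallyEq ?_
    filter_upwards [Iio_mem_nhds h] with t ht
    rw [max_eq_left (le_of_lt ht), zero_pow (by omega)]
  · rw [max_self, zero_pow (Nat.succ_ne_zero k), mul_zero, hasDerivAt_iff_isLittleO]
    refine Asymptotics.IsBigO.trans_isLittleO (g := fun s : ℝ => s ^ 2) ?_ ?_
    · refine Asymptotics.IsBigO.of_bound 1 ?_
      filter_upwards [Metric.ball_mem_nhds (0 : ℝ) one_pos] with t ht
      have ht1 : |t| < 1 := by simpa [Real.dist_eq] using ht
      have h0 : |max 0 t| ≤ |t| := by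
        rcases le_total t 0 with h | h
        · simp [h]
        · simp [h]
      have h2 : |max 0 t| ^ k ≤ 1 := pow_le_one₀ (abs_nonneg _) (h0.trans ht1.le)
      have h3 : |max 0 t| ^ 2 ≤ |t| ^ 2 := by gcongr
      simp only [max_self, smul_zero, sub_zero, Real.norm_eq_abs, one_mul, ne_eq,
        OfNat.ofNat_ne_zero, not_false_eq_true, zero_pow, pow_add, mul_zero, abs_mul, abs_pow]
      calc |max 0 t| ^ k * |max 0 t| ^ 2 ≤ 1 * |t| ^ 2 := by gcongr
        _ = |t| ^ 2 := one_mul _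
    · simpa using Asymptotics.isLittleO_pow_id (𝕜 := ℝ) (n := 2) (by norm_num)
  · have h1 := hasDerivAt_pow (k + 2) s
    rw [max_eq_right h.le]
    push_cast at h1
    refine HasDerivAt.congr_of_eventuallyEq h1 ?_
    filter_upwards [Ioi_mem_nhds h] with t ht
    rw [max_eq_right (le_of_lt ht)]

theorem contDiff_max_zero_pow (r : ℕ) : ContDiff ℝ r fun s : ℝ => max 0 s ^ (r + 1) := by
  induction r with
  | zero =>
    rw [Nat.cast_zero, contDiff_zero]
    fun_prop
  | succ r ih =>
    push_cast
    rw [contDiff_succ_iff_deriv]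
    refine ⟨fun s => (hasDerivAt_max_zero_pow r s).differentiableAt, by simp, ?_⟩
    rw [show deriv (fun s : ℝ => max 0 s ^ (r + 1 + 1)) =
      fun s : ℝ => ((r : ℝ) + 2) * max 0 s ^ (r + 1) from
        funext fun s => (hasDerivAt_max_zero_pow r s).deriv]
    exact contDiff_const.mul ih

variable [hL : Fact (ExpandsOrderedField L)]

/-- Definable `C^r` bump functions. -/
theorem exists_bump (r : ℕ) {d : ℕ} (y₀ : Fin d → ℝ) {ε : ℝ} (hε : 0 < ε) :
    ∃ (β : (Fin d → ℝ) → ℝ) (C K : Set (Fin d → ℝ)), DF L β ∧ ContDiff ℝ r β ∧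
      IsOpen C ∧ DP L (· ∈ C) ∧ y₀ ∈ C ∧ C ⊆ Metric.ball y₀ ε ∧ (∀ y ∈ C, β y = 1) ∧
      IsCompact K ∧ K ⊆ Metric.ball y₀ ε ∧ ∀ y ∉ K, β y = 0 := by
  let q : (Fin d → ℝ) → ℝ := fun y => ∑ j, ((y j - y₀ j) / (ε / 4)) ^ 2
  let w : ℝ → ℝ := fun s => max 0 s ^ (r + 1)
  have hwp : ∀ s, 0 < s → 0 < w s := fun s hs => pow_pos (lt_max_of_lt_right hs) _
  have hw0 : ∀ s, s ≤ 0 → w s = 0 := fun s hs => by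
    simp only [w, max_eq_left hs, zero_pow (Nat.succ_ne_zero r)]
  have hwn : ∀ s, 0 ≤ w s := fun s => pow_nonneg (le_max_left _ _) _
  have hden : ∀ y, w (4 - q y) + w (q y - 1) ≠ 0 := by
    intro y
    rcases lt_or_ge (q y) 4 with h | h
    · exact (add_pos_of_pos_of_nonneg (hwp _ (by linarith)) (hwn _)).ne'
    · exact (add_pos_of_nonneg_of_pos (hwn _) (hwp _ (by linarith))).ne'
  have hqc : ContDiff ℝ r q := by fun_prop
  have hwc : ContDiff ℝ r w := contDiff_max_zero_pow r
  have hqd : DF L q := DF.sum _ fun j => (((DF.eval j).sub (DF.const _)).div (DF.const _)).pow 2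
  have hwd : DF L w := ((DF.const 0).max DF.id).pow _
  have hqball : ∀ y, q y ≤ 4 → y ∈ Metric.closedBall y₀ (ε / 2) := by
    intro y hy
    rw [Metric.mem_closedBall, dist_pi_le_iff (by positivity)]
    intro j
    have h1 : ((y j - y₀ j) / (ε / 4)) ^ 2 ≤ 2 ^ 2 :=
      (Finset.single_le_sum (f := fun j => ((y j - y₀ j) / (ε / 4)) ^ 2)
        (fun _ _ => sq_nonneg _) (Finset.mem_univ j)).trans (hy.trans (by norm_num))
    have h2 := abs_le_of_sq_le_sq h1 (by norm_num)
    rw [Real.dist_eq]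
    rw [abs_div, abs_of_pos (show 0 < ε / 4 by positivity), div_le_iff₀ (by positivity)] at h2
    linarith
  have hsub : Metric.closedBall y₀ (ε / 2) ⊆ Metric.ball y₀ ε :=
    Metric.closedBall_subset_ball (half_lt_self hε)
  have h4 : DF L fun y => w (4 - q y) := hwd.comp ((DF.const 4).sub hqd)
  have h1 : DF L fun y => w (q y - 1) := hwd.comp (hqd.sub (DF.const 1))
  refine ⟨fun y => w (4 - q y) / (w (4 - q y) + w (q y - 1)), {y | q y < 1},
    Metric.closedBall y₀ (ε / 2), h4.div (h4.add h1), ?_,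
    isOpen_lt hqc.continuous continuous_const, DP.lt hqd (DF.const 1), ?_, ?_, ?_,
    isCompact_closedBall _ _, hsub, ?_⟩
  · have h4c := hwc.comp (contDiff_const.sub hqc : ContDiff ℝ r fun y => 4 - q y)
    have h1c := hwc.comp (hqc.sub contDiff_const : ContDiff ℝ r fun y => q y - 1)
    exact h4c.div (h4c.add h1c) hden
  · simp [q]
  · exact fun y hy => hsub (hqball y (le_of_lt (lt_trans hy (by norm_num))))
  · intro y hy
    have hy : q y < 1 := hy
    have h := hden y
    dsimp only
    rw [hw0 (q y - 1) (by linarith)] at h ⊢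
    rw [add_zero] at h ⊢
    exact div_self h
  · intro y hy
    have : 4 - q y ≤ 0 := by
      by_contra! h
      exact hy (hqball y (by linarith))
    simp only [hw0 _ this, zero_div]

end Bump

section CrGroup

variable (L) in
/-- A compact definable `C^r` group `G` in `ℝᴺ` together with a definable subgroup `H`. -/
structure CrGroup (r N : ℕ) where
  G : Set (Fin N → ℝ)
  H : Set (Fin N → ℝ)
  mul : (Fin N → ℝ) → (Fin N → ℝ) → (Fin N → ℝ)
  inv : (Fin N → ℝ) → (Fin N → ℝ)
  one : Fin N → ℝ
  isCompact : IsCompact G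
  definable_G : DP L (· ∈ G)
  definable_H : DP L (· ∈ H)
  definable_mul : DF L fun z : (Fin N → ℝ) × (Fin N → ℝ) => mul z.1 z.2
  definable_inv : DF L inv
  crOn_mul : CrOn r (fun z : (Fin N → ℝ) × (Fin N → ℝ) => mul z.1 z.2) (G ×ˢ G)
  crOn_inv : CrOn r inv G
  one_mem : one ∈ H
  mul_mem : ∀ {x y}, x ∈ G → y ∈ G → mul x y ∈ G
  inv_mem : ∀ {x}, x ∈ G → inv x ∈ G
  mul_assoc : ∀ x ∈ G, ∀ y ∈ G, ∀ z ∈ G, mul (mul x y) z = mul x (mul y z)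
  one_mul : ∀ x ∈ G, mul one x = x
  mul_one : ∀ x ∈ G, mul x one = x
  inv_mul_cancel : ∀ x ∈ G, mul (inv x) x = one
  H_subset : H ⊆ G
  H_mul_mem : ∀ {x y}, x ∈ H → y ∈ H → mul x y ∈ H
  H_inv_mem : ∀ {x}, x ∈ H → inv x ∈ H

namespace CrGroup

variable {r N : ℕ} (A : CrGroup L r N)

/-- The abstract group underlying `A`. -/
@[reducible]
def group : Group A.G where
  mul x y := ⟨A.mul x y, A.mul_mem x.2 y.2⟩
  inv x := ⟨A.inv x, A.inv_mem x.2⟩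
  one := ⟨A.one, A.H_subset A.one_mem⟩
  mul_assoc x y z := Subtype.ext (A.mul_assoc x x.2 y y.2 z z.2)
  one_mul x := Subtype.ext (A.one_mul x x.2)
  mul_one x := Subtype.ext (A.mul_one x x.2)
  inv_mul_cancel x := Subtype.ext (A.inv_mul_cancel x x.2)

/-- The subgroup `H` of the abstract group underlying `A`. -/
def subgroup : letI := A.group; Subgroup A.G :=
  letI := A.group
  { carrier := {x | (x : Fin N → ℝ) ∈ A.H}
    mul_mem' := fun hx hy => A.H_mul_mem hx hy
    one_mem' := A.one_mem
    inv_mem' := fun hx => A.H_inv_mem hx }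

theorem isTopologicalGroup : letI := A.group; IsTopologicalGroup A.G :=
  letI := A.group
  { continuous_mul := by
      have h := continuousOn_iff_continuous_domRestrict.1 A.crOn_mul.continuousOn
      have h2 : Continuous fun z : A.G × A.G => (⟨(z.1, z.2), z.1.2, z.2.2⟩ : A.G ×ˢ A.G) := by
        fun_prop
      exact Continuous.subtype_mk (h.comp h2) _
    continuous_inv := by
      have h := continuousOn_iff_continuous_domRestrict.1 A.crOn_inv.continuousOn
      exact Continuous.subtype_mk h _ }

/-- `x` and `y` lie in the same left coset of `H`. -/
def Rel (x y : Fin N → ℝ) : Prop := A.mul (A.inv x) y ∈ A.H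

variable {A} {x y z a b h : Fin N → ℝ}

theorem rel_iff (hx : x ∈ A.G) (hy : y ∈ A.G) : A.Rel x y ↔
    letI := A.group; (⟨x, hx⟩ : A.G)⁻¹ * ⟨y, hy⟩ ∈ A.subgroup := Iff.rfl

theorem Rel.refl (hx : x ∈ A.G) : A.Rel x x := by
  let := A.group
  rw [rel_iff hx hx, _root_.inv_mul_cancel]
  exact A.subgroup.one_mem

theorem Rel.symm (hx : x ∈ A.G) (hy : y ∈ A.G) (h : A.Rel x y) : A.Rel y x := by
  let := A.group
  rw [rel_iff hx hy] at h
  rw [rel_iff hy hx]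
  simpa using A.subgroup.inv_mem h

theorem Rel.trans (hx : x ∈ A.G) (hy : y ∈ A.G) (hz : z ∈ A.G) (h : A.Rel x y)
    (h' : A.Rel y z) : A.Rel x z := by
  let := A.group
  rw [rel_iff hx hy] at h
  rw [rel_iff hy hz] at h'
  rw [rel_iff hx hz]
  simpa [_root_.mul_assoc] using A.subgroup.mul_mem h h'

theorem rel_mul_right (hx : x ∈ A.G) (hh : h ∈ A.H) : A.Rel x (A.mul x h) := by
  let := A.group
  rw [rel_iff hx (A.mul_mem hx (A.H_subset hh))]
  change (⟨x, hx⟩ : A.G)⁻¹ * (⟨x, hx⟩ * ⟨h, A.H_subset hh⟩) ∈ A.subgroup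
  rw [inv_mul_cancel_left]
  exact hh

theorem rel_mul_left (hb : b ∈ A.G) (hx : x ∈ A.G) (hy : y ∈ A.G) :
    A.Rel (A.mul b x) (A.mul b y) ↔ A.Rel x y := by
  let := A.group
  rw [rel_iff (A.mul_mem hb hx) (A.mul_mem hb hy), rel_iff hx hy]
  change ((⟨b, hb⟩ : A.G) * ⟨x, hx⟩)⁻¹ * (⟨b, hb⟩ * ⟨y, hy⟩) ∈ A.subgroup ↔ _
  simp [_root_.mul_assoc]

theorem mul_inv_cancel_left (hb : b ∈ A.G) (hx : x ∈ A.G) : A.mul b (A.mul (A.inv b) x) = x := by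
  let := A.group
  exact congrArg Subtype.val (_root_.mul_inv_cancel_left (⟨b, hb⟩ : A.G) ⟨x, hx⟩)

theorem inv_mul_cancel_left (hb : b ∈ A.G) (hx : x ∈ A.G) : A.mul (A.inv b) (A.mul b x) = x := by
  let := A.group
  exact congrArg Subtype.val (_root_.inv_mul_cancel_left (⟨b, hb⟩ : A.G) ⟨x, hx⟩)

theorem Rel.exists_mul (hx : x ∈ A.G) (hy : y ∈ A.G) (h : A.Rel x y) :
    ∃ h ∈ A.H, A.mul x h = y :=
  ⟨_, h, mul_inv_cancel_left hx hy⟩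

theorem Rel.mul_mul (hn : ∀ g ∈ A.G, ∀ h ∈ A.H, A.mul (A.mul g h) (A.inv g) ∈ A.H)
    (hx : x ∈ A.G) (hy : y ∈ A.G) (ha : a ∈ A.G) (hb : b ∈ A.G) (h : A.Rel x y)
    (h' : A.Rel a b) : A.Rel (A.mul x a) (A.mul y b) := by
  let := A.group
  have : A.subgroup.Normal := ⟨fun h hh g => hn g g.2 h hh⟩
  rw [rel_iff hx hy, ← QuotientGroup.eq] at h
  rw [rel_iff ha hb, ← QuotientGroup.eq] at h'
  rw [rel_iff (A.mul_mem hx ha) (A.mul_mem hy hb), ← QuotientGroup.eq]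
  change (((⟨x, hx⟩ * ⟨a, ha⟩ : A.G) : A.G ⧸ A.subgroup)) =
    ((⟨y, hy⟩ * ⟨b, hb⟩ : A.G) : A.G ⧸ A.subgroup)
  rw [QuotientGroup.mk_mul, QuotientGroup.mk_mul, h, h']

theorem Rel.inv_inv (hn : ∀ g ∈ A.G, ∀ h ∈ A.H, A.mul (A.mul g h) (A.inv g) ∈ A.H)
    (hx : x ∈ A.G) (hy : y ∈ A.G) (h : A.Rel x y) : A.Rel (A.inv x) (A.inv y) := by
  let := A.group
  have : A.subgroup.Normal := ⟨fun h hh g => hn g g.2 h hh⟩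
  rw [rel_iff hx hy, ← QuotientGroup.eq] at h
  rw [rel_iff (A.inv_mem hx) (A.inv_mem hy), ← QuotientGroup.eq]
  change ((((⟨x, hx⟩ : A.G)⁻¹ : A.G) : A.G ⧸ A.subgroup)) =
    (((⟨y, hy⟩ : A.G)⁻¹ : A.G) : A.G ⧸ A.subgroup)
  rw [QuotientGroup.mk_inv, QuotientGroup.mk_inv, h]

theorem crOn_mul_left (hb : b ∈ A.G) : CrOn r (A.mul b) A.G :=
  A.crOn_mul.comp ((ContDiff.crOn _ contDiff_const).prodMk (ContDiff.crOn _ contDiff_id))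
    fun _ hx => ⟨hb, hx⟩

theorem crOn_mul_right (hb : b ∈ A.G) : CrOn r (fun x => A.mul x b) A.G :=
  A.crOn_mul.comp ((ContDiff.crOn _ contDiff_id).prodMk (ContDiff.crOn _ contDiff_const))
    fun _ hx => ⟨hx, hb⟩

theorem DF_mul {E : Type} [Coord E] {f g : E → Fin N → ℝ} (hf : DF L f) (hg : DF L g) :
    DF L fun x => A.mul (f x) (g x) :=
  A.definable_mul.comp (hf.prodMk hg)

theorem DF_inv {E : Type} [Coord E] {f : E → Fin N → ℝ} (hf : DF L f) :
    DF L fun x => A.inv (f x) :=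
  A.definable_inv.comp hf

theorem DP_rel {E : Type} [Coord E] {f g : E → Fin N → ℝ} (hf : DF L f) (hg : DF L g) :
    DP L fun x => A.Rel (f x) (g x) :=
  A.definable_H.comp (DF_mul (DF_inv hf) hg)

end CrGroup
end CrGroup

section Slice

variable (L) in
/-- A definable `C^r` parametrisation by an open set of `ℝⁿ` of a relatively open subset of
`M ⊆ ℝᴺ`. -/
structure Chart (r n : ℕ) {N : ℕ} (M : Set (Fin N → ℝ)) where
  B : Set (Fin n → ℝ)
  U : Set (Fin N → ℝ)
  c : (Fin n → ℝ) → (Fin N → ℝ)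
  φ : (Fin N → ℝ) → (Fin n → ℝ)
  isOpen_B : IsOpen B
  nonempty_B : B.Nonempty
  isOpen_U : IsOpen U
  definable_U : DP L (· ∈ U)
  definable_c : DF L c
  definable_φ : DF L φ
  contDiffOn_c : ContDiffOn ℝ r c B
  contDiffOn_φ : ContDiffOn ℝ r φ U
  c_mem : ∀ y ∈ B, c y ∈ M ∩ U
  φ_mem : ∀ x ∈ M ∩ U, φ x ∈ B
  φ_c : ∀ y ∈ B, φ (c y) = y
  c_φ : ∀ x ∈ M ∩ U, c (φ x) = x

variable {r N n : ℕ}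

theorem IsDefCrSubmanifold.exists_chart {M : Set (Fin N → ℝ)} (hM : IsDefCrSubmanifold L r N n M)
    (hn : n ≤ N) (hne : M.Nonempty) : Nonempty (Chart L r n M) := by
  obtain ⟨a, ha⟩ := hne
  obtain ⟨U, V, φ, ψ, haU, hUo, hUd, h0V, hVo, hVd, hφd, hψd, hφr, hψr, hbij, hinv, hφa, himg⟩ :=
    hM.2 a ha
  obtain ⟨φ', hφ'd, hφ'⟩ := hφd.exists_DF hUd
  obtain ⟨ψ', hψ'd, hψ'⟩ := hψd.exists_DF hVd
  let pad : (Fin n → ℝ) → (Fin N → ℝ) := fun y i => if h : (i : ℕ) < n then y ⟨i, h⟩ else 0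
  let cut : (Fin N → ℝ) → (Fin n → ℝ) := fun x j => x (Fin.castLE hn j)
  have hpadd : DF L pad := DF.pi fun i => by
    by_cases h : (i : ℕ) < n
    · simpa only [pad, h, dif_pos] using DF.eval _
    · simpa only [pad, h, dif_neg, not_false_eq_true] using DF.const _
  have hcutd : DF L cut := DF.pi fun j => DF.eval _
  have hpadc : ContDiff ℝ r pad := contDiff_pi.2 fun i => by
    by_cases h : (i : ℕ) < n
    · simpa only [pad, h, dif_pos] using contDiff_apply _ _ _
    · simpa only [pad, h, dif_neg, not_false_eq_true] using contDiff_const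
  have hcutc : ContDiff ℝ r cut := contDiff_pi.2 fun j => contDiff_apply _ _ _
  have hcutpad : ∀ y, cut (pad y) = y := fun y => funext fun j => by simp [cut, pad]
  have hpadcut : ∀ x, (∀ i : Fin N, n ≤ (i : ℕ) → x i = 0) → pad (cut x) = x := fun x hx =>
    funext fun i => by
      by_cases h : (i : ℕ) < n
      · simp [cut, pad, h]
      · simp [pad, h, hx i (not_lt.1 h)]
  have hpad0 : ∀ y (i : Fin N), n ≤ (i : ℕ) → pad y i = 0 := fun y i hi => by
    simp [pad, not_lt.2 hi]
  have hmem : ∀ y, pad y ∈ V → ψ (pad y) ∈ M ∩ U ∧ φ (ψ (pad y)) = pad y := by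
    intro y hy
    have h1 : pad y ∈ φ '' (M ∩ U) := by
      rw [himg]
      exact ⟨hy, hpad0 y⟩
    obtain ⟨x, hx, hxy⟩ := h1
    have h2 : ψ (pad y) = x := by rw [← hxy, hinv.1 hx.2]
    rw [h2]
    exact ⟨hx, hxy⟩
  have hφmem : ∀ x ∈ M ∩ U, φ x ∈ V ∧ pad (cut (φ x)) = φ x := by
    intro x hx
    have h1 : φ x ∈ φ '' (M ∩ U) := mem_image_of_mem _ hx
    rw [himg] at h1
    exact ⟨h1.1, hpadcut _ h1.2⟩
  refine ⟨{ B := pad ⁻¹' V, U, c := fun y => ψ' (pad y), φ := fun x => cut (φ' x)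
            isOpen_B := hVo.preimage hpadc.continuous
            nonempty_B := ⟨cut (φ a), ?_⟩
            isOpen_U := hUo
            definable_U := hUd
            definable_c := hψ'd.comp hpadd
            definable_φ := hcutd.comp hφ'd
            contDiffOn_c := (hψr.congr hψ').comp hpadc.contDiffOn fun y hy => hy
            contDiffOn_φ := hcutc.comp_contDiffOn (hφr.congr hφ')
            c_mem := ?_
            φ_mem := ?_
            φ_c := ?_
            c_φ := ?_ }⟩
  · rw [mem_preimage, (hφmem a ⟨ha, haU⟩).2]
    exact (hφmem a ⟨ha, haU⟩).1
  · intro y hy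
    rw [hψ' hy]
    exact (hmem y hy).1
  · intro x hx
    rw [hφ' hx.2, mem_preimage, (hφmem x hx).2]
    exact (hφmem x hx).1
  · intro y hy
    rw [hψ' hy, hφ' (hmem y hy).1.2, (hmem y hy).2, hcutpad]
  · intro x hx
    rw [hφ' hx.2, (hφmem x hx).2, hψ' (hφmem x hx).1, hinv.1 hx.2]

variable (L) in
/-- A definable `C^r` local section of the projection of `G` onto its left cosets modulo `H`. -/
structure Slice (A : CrGroup L r N) (d : ℕ) where
  Ω : Set (Fin N → ℝ)
  u : (Fin N → ℝ) → (Fin d → ℝ)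
  σ : (Fin d → ℝ) → (Fin N → ℝ)
  y₀ : Fin d → ℝ
  ε : ℝ
  ε_pos : 0 < ε
  Ω_subset : Ω ⊆ A.G
  definable_Ω : DP L (· ∈ Ω)
  exists_isOpen : ∃ W, IsOpen W ∧ Ω = A.G ∩ W
  definable_u : DF L u
  crOn_u : CrOn r u Ω
  u_mem : ∀ x ∈ Ω, u x ∈ Metric.ball y₀ ε
  definable_σ : DF L σ
  contDiffOn_σ : ContDiffOn ℝ r σ (Metric.ball y₀ ε)
  σ_mem : ∀ y ∈ Metric.ball y₀ ε, σ y ∈ Ω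
  u_σ : ∀ y ∈ Metric.ball y₀ ε, u (σ y) = y
  u_eq_iff : ∀ x ∈ Ω, ∀ x' ∈ Ω, u x = u x' ↔ A.Rel x x'
  mem_of_rel : ∀ x ∈ Ω, ∀ x' ∈ A.G, A.Rel x x' → x' ∈ Ω

theorem _root_.Subgroup.isClosed_of_locally_eq {Γ Y : Type*} [Group Γ] [TopologicalSpace Γ]
    [IsTopologicalGroup Γ] [TopologicalSpace Y] [T1Space Y] (K : Subgroup Γ) {V : Set Γ}
    (hV : IsOpen V) (h1 : 1 ∈ V) {f : Γ → Y} (hf : ContinuousOn f V)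
    (hK : ∀ z ∈ V, z ∈ K ↔ f z = f 1) : IsClosed (K : Set Γ) := by
  refine isClosed_of_closure_subset fun x hx => ?_
  have ho : IsOpen {h : Γ | h⁻¹ * x ∈ V} := hV.preimage (by fun_prop)
  obtain ⟨h, hhV, hhK⟩ := mem_closure_iff.1 hx _ ho (by simpa using h1)
  have hz : h⁻¹ * x ∈ K.topologicalClosure :=
    mul_mem (K.le_topologicalClosure (K.inv_mem hhK)) hx
  have hz2 : h⁻¹ * x ∈ closure (V ∩ K) := hV.inter_closure ⟨hhV, hz⟩
  have h3 := ((hf _ hhV).mono inter_subset_left).mem_closure_image hz2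
  have h4 : f '' (V ∩ K) ⊆ {f 1} := by
    rintro _ ⟨z, ⟨hzV, hzK⟩, rfl⟩
    exact (hK z hzV).1 hzK
  have h5 : f (h⁻¹ * x) = f 1 := by simpa using closure_mono h4 h3
  have := K.mul_mem hhK ((hK _ hhV).2 h5)
  rwa [_root_.mul_inv_cancel_left] at this

theorem Slice.isClosed_H {A : CrGroup L r N} {d : ℕ} (S : Slice L A d) : IsClosed A.H := by
  let := A.group
  have := A.isTopologicalGroup
  obtain ⟨W, hW, hΩ⟩ := S.exists_isOpen
  have hg := S.σ_mem _ (Metric.mem_ball_self S.ε_pos)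
  have hgG := S.Ω_subset hg
  generalize S.σ S.y₀ = g at hg hgG
  let m : A.G → A.G := fun z => ⟨g, hgG⟩ * z
  have hm : Continuous m := by fun_prop
  have hmΩ : ∀ z : A.G, (m z : Fin N → ℝ) ∈ W ↔ (m z : Fin N → ℝ) ∈ S.Ω := fun z => by
    rw [hΩ]
    exact ⟨fun h => ⟨(m z).2, h⟩, fun h => h.2⟩
  have hm1 : (m 1 : Fin N → ℝ) = g := A.mul_one g hgG
  have key : IsClosed (A.subgroup : Set A.G) := by
    refine A.subgroup.isClosed_of_locally_eq (V := {z | (m z : Fin N → ℝ) ∈ W})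
      (f := fun z => S.u (m z)) (hW.preimage (by fun_prop)) ?_ ?_ fun z hz => ?_
    · rw [mem_ofPred, hmΩ, hm1]
      exact hg
    · exact S.crOn_u.continuousOn.comp (by fun_prop) fun z hz => (hmΩ z).1 hz
    · rw [hm1, eq_comm, S.u_eq_iff g hg _ ((hmΩ z).1 hz)]
      change z ∈ A.subgroup ↔ A.mul (A.inv g) (A.mul g z) ∈ A.H
      rw [CrGroup.inv_mul_cancel_left hgG z.2]
      rfl
  have h2 := A.isCompact.isClosed.isClosedEmbedding_subtypeVal.isClosedMap _ key
  have h3 : Subtype.val '' (A.subgroup : Set A.G) = A.H := by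
    ext x
    constructor
    · rintro ⟨z, hz, rfl⟩
      exact hz
    · exact fun hx => ⟨⟨x, A.H_subset hx⟩, hx, rfl⟩
  rwa [h3] at h2

section Existence

variable [hL : Fact (ExpandsOrderedField L)] [hO : Fact (LocallyOMinimal L)]

theorem CrGroup.exists_slice (A : CrGroup L r N) (C : Chart L r n A.G) {dH : ℕ}
    (hH : HasDim A.H dH) : ∃ d, d + dH = n ∧ Nonempty (Slice L A d) := by
  obtain ⟨M, hM⟩ := A.isCompact.isBounded.exists_norm_le
  obtain ⟨t, htd, ht1, ht2⟩ := exists_choice (L := L) (E := Fin N → ℝ)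
    (R := fun g x => x ∈ A.G ∧ A.Rel g x)
    ((A.definable_G.comp DF.snd').and (CrGroup.DP_rel DF.fst' DF.snd'))
    (fun g => ⟨M, fun x hx i => (norm_le_pi_norm x i).trans (hM x hx.1)⟩)
  have ht : ∀ g ∈ A.G, ∀ g' ∈ A.G, t g = t g' ↔ A.Rel g g' := by
    intro g hg g' hg'
    constructor
    · intro h
      have h1 := ht1 g ⟨g, hg, .refl hg⟩
      have h2 := ht1 g' ⟨g', hg', .refl hg'⟩
      rw [← h] at h2
      exact h1.2.trans hg h1.1 hg' (h2.2.symm hg' h2.1)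
    · intro h
      refine ht2 g g' fun x => and_congr_right fun hx => ?_
      exact ⟨fun h' => (h.symm hg hg').trans hg' hg hx h', fun h' => h.trans hg hg' hx h'⟩
  obtain ⟨S⟩ := (htd.comp C.definable_c).exists_normalForm r C.isOpen_B C.nonempty_B
  have hz₀ := Metric.mem_ball_self (x := S.z₀) S.ε_pos
  have hy₀ := Metric.mem_ball_self (x := S.y₀) S.ε_pos
  let U₁ := C.U ∩ C.φ ⁻¹' Metric.ball S.x₀ S.δ
  let pF : (Fin N → ℝ) → (Fin S.d → ℝ) := fun x i => t (C.c (C.φ x)) (S.p i)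
  let W := U₁ ∩ (fun x => (pF x, S.Q (C.φ x))) ⁻¹' (Metric.ball S.y₀ S.ε ×ˢ Metric.ball S.z₀ S.ε)
  have hU₁ : IsOpen U₁ :=
    C.contDiffOn_φ.continuousOn.isOpen_inter_preimage C.isOpen_U Metric.isOpen_ball
  have hφU₁ : ContDiffOn ℝ r C.φ U₁ := C.contDiffOn_φ.mono inter_subset_left
  have hpF : ContDiffOn ℝ r pF U₁ := contDiffOn_pi.2 fun i =>
    (contDiffOn_pi.1 S.contDiffOn_F (S.p i)).comp hφU₁ fun x hx => hx.2
  have hW : IsOpen W := (hpF.continuousOn.prodMk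
    (S.Q.continuous.comp_continuousOn hφU₁.continuousOn)).isOpen_inter_preimage hU₁
      (Metric.isOpen_ball.prod Metric.isOpen_ball)
  have hWd : DP L (· ∈ W) :=
    (C.definable_U.and (DP.mem_ball C.definable_φ _ _)).and
      ((DP.mem_ball (DF.pi fun i => ((htd.comp C.definable_c).comp C.definable_φ).apply _) _ _).and
        (DP.mem_ball ((DF.clm S.Q).comp C.definable_φ) _ _))
  have hc : ∀ x ∈ A.G ∩ W, C.c (C.φ x) = x := fun x hx => C.c_φ x ⟨hx.1, hx.2.1.1⟩
  have hκφ : ∀ x ∈ A.G ∩ W, S.κ (pF x, S.Q (C.φ x)) = C.φ x := fun x hx =>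
    S.κ_left (C.φ x) hx.2.1.2 hx.2.2.1 hx.2.2.2
  have hcκ : ∀ y ∈ Metric.ball S.y₀ S.ε, ∀ z ∈ Metric.ball S.z₀ S.ε,
      C.c (S.κ (y, z)) ∈ A.G ∩ W ∧ C.φ (C.c (S.κ (y, z))) = S.κ (y, z) ∧
        t (C.c (S.κ (y, z))) = t (C.c (S.κ (y, S.z₀))) := by
    intro y hy z hz
    have h1 := S.κ_mem y hy z hz
    have h2 := C.c_mem _ (S.ball_subset h1)
    have h3 := C.φ_c _ (S.ball_subset h1)
    refine ⟨⟨h2.1, ⟨h2.2, by rwa [mem_preimage, h3]⟩, ?_, ?_⟩, h3, S.F_const y hy z hz⟩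
    · have : pF (C.c (S.κ (y, z))) = y := by
        simp only [pF, h3]
        exact S.F_κ y hy z hz
      change pF _ ∈ _
      rwa [this]
    · change S.Q _ ∈ _
      rwa [h3, S.Q_κ y hy z hz]
  let σ : (Fin S.d → ℝ) → (Fin N → ℝ) := fun y => C.c (S.κ (y, S.z₀))
  let u : (Fin N → ℝ) → (Fin S.d → ℝ) := fun x i => t x (S.p i)
  have huW : ∀ x ∈ A.G ∩ W, u x = pF x := fun x hx => by simp only [u, pF, hc x hx]
  have hσ : ∀ y ∈ Metric.ball S.y₀ S.ε, u (σ y) = y := fun y hy => S.F_κ y hy _ hz₀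
  have hσu : ∀ x ∈ A.G ∩ W, t (σ (u x)) = t x := fun x hx => by
    have h1 : u x ∈ Metric.ball S.y₀ S.ε := by
      rw [huW x hx]
      exact hx.2.2.1
    have h2 := (hcκ _ h1 _ hx.2.2.2).2.2
    rw [huW x hx, hκφ x hx, hc x hx, ← huW x hx] at h2
    exact h2.symm
  let Ω : Set (Fin N → ℝ) := {x | x ∈ A.G ∧ ∃ h ∈ A.H, A.mul x h ∈ W}
  have hΩ : ∀ x ∈ Ω, ∃ x' ∈ A.G ∩ W, A.Rel x x' ∧ t x = t x' := by
    rintro x ⟨hx, h, hh, hxh⟩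
    have h1 := A.mul_mem hx (A.H_subset hh)
    exact ⟨_, ⟨h1, hxh⟩, CrGroup.rel_mul_right hx hh,
      (ht _ hx _ h1).2 (CrGroup.rel_mul_right hx hh)⟩
  have hΩW : ∀ x ∈ A.G ∩ W, x ∈ Ω := fun x hx =>
    ⟨hx.1, A.one, A.one_mem, by rw [A.mul_one x hx.1]; exact hx.2⟩
  have hopen : ∀ h ∈ A.H, ∃ O, IsOpen O ∧ ∀ x ∈ A.G, A.mul x h ∈ W ↔ x ∈ O := by
    intro h hh
    obtain ⟨O, hO, hO'⟩ := continuousOn_iff'.1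
      (CrGroup.crOn_mul_right (A.H_subset hh)).continuousOn W hW
    refine ⟨O, hO, fun x hx => ?_⟩
    have := Set.ext_iff.1 hO' x
    simpa [hx] using this
  choose! O hOo hO using hopen
  have hue : ∀ x ∈ Ω, ∀ x' ∈ Ω, u x = u x' ↔ A.Rel x x' := by
    intro x hx x' hx'
    rw [← ht x hx.1 x' hx'.1]
    refine ⟨fun h => ?_, fun h => by simp only [u, h]⟩
    obtain ⟨w, hw, -, hxw⟩ := hΩ x hx
    obtain ⟨w', hw', -, hxw'⟩ := hΩ x' hx'
    have h1 : u w = u w' := by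
      simp only [u, ← hxw, ← hxw']
      exact h
    rw [hxw, hxw', ← hσu w hw, ← hσu w' hw', h1]
  have hg : σ S.y₀ ∈ A.G ∩ W := (hcκ _ hy₀ _ hz₀).1
  have hle : S.e ≤ dH := by
    let F : (Fin S.e → ℝ) → (Fin N → ℝ) := fun z =>
      A.mul (A.inv (σ S.y₀)) (C.c (S.κ (S.y₀, z)))
    have hFd : DF L F := CrGroup.DF_mul (DF.const _)
      (C.definable_c.comp (S.definable_κ.comp ((DF.const _).prodMk DF.id)))
    have hFH : F '' Metric.ball S.z₀ S.ε ⊆ A.H := by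
      rintro _ ⟨z, hz, rfl⟩
      obtain ⟨h1, -, h3⟩ := hcκ _ hy₀ z hz
      exact (ht _ hg.1 _ h1.1).1 h3.symm
    have hinj : InjOn F (Metric.ball S.z₀ S.ε) := by
      intro z hz z' hz' h
      obtain ⟨h1, h2, -⟩ := hcκ _ hy₀ z hz
      obtain ⟨h1', h2', -⟩ := hcκ _ hy₀ z' hz'
      have h3 := congrArg (A.mul (σ S.y₀)) h
      simp only [F, CrGroup.mul_inv_cancel_left hg.1 h1.1,
        CrGroup.mul_inv_cancel_left hg.1 h1'.1] at h3
      have h4 := congrArg C.φ h3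
      rw [h2, h2'] at h4
      have h5 := congrArg S.Q h4
      rwa [S.Q_κ _ hy₀ _ hz, S.Q_κ _ hy₀ _ hz'] at h5
    obtain ⟨p, hp, hpint⟩ := exists_interior_coordProj_image hFd Metric.isOpen_ball ⟨_, hz₀⟩ hinj
    exact hH.2 _ p hp (hpint.mono (interior_mono (image_mono hFH)))
  have hge : dH ≤ S.e := by
    obtain ⟨τ, -, hτ⟩ := hH.1
    refine le_of_locally_injOn A.definable_H (A.isCompact.isBounded.subset A.H_subset)
      (fun a ha => ?_) τ hτ
    have haG := A.H_subset ha
    have hmul : CrOn r (fun h => A.mul (σ S.y₀) (A.mul (A.inv a) h)) A.G :=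
      (CrGroup.crOn_mul_left hg.1).comp (CrGroup.crOn_mul_left (A.inv_mem haG))
        fun x hx => A.mul_mem (A.inv_mem haG) hx
    obtain ⟨V, hV, hV'⟩ := continuousOn_iff'.1 hmul.continuousOn W hW
    have hVW : ∀ x ∈ A.G, A.mul (σ S.y₀) (A.mul (A.inv a) x) ∈ W ↔ x ∈ V := by
      intro x hx
      have := Set.ext_iff.1 hV' x
      simpa [hx] using this
    refine ⟨V, hV.mem_nhds ((hVW a haG).1 ?_),
      fun h => S.Q (C.φ (A.mul (σ S.y₀) (A.mul (A.inv a) h))),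
      (DF.clm S.Q).comp (C.definable_φ.comp
        (CrGroup.DF_mul (DF.const _) (CrGroup.DF_mul (DF.const _) DF.id))), ?_⟩
    · rw [A.inv_mul_cancel a haG, A.mul_one _ hg.1]
      exact hg.2
    · have key : ∀ h ∈ A.H ∩ V, A.mul (σ S.y₀) (A.mul (A.inv a) h) ∈ A.G ∩ W ∧
          pF (A.mul (σ S.y₀) (A.mul (A.inv a) h)) = pF (σ S.y₀) := by
        rintro h ⟨hh, hhV⟩
        have h1 := A.H_mul_mem (A.H_inv_mem ha) hh
        have h2 : A.mul (σ S.y₀) (A.mul (A.inv a) h) ∈ A.G ∩ W :=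
          ⟨A.mul_mem hg.1 (A.H_subset h1), (hVW h (A.H_subset hh)).2 hhV⟩
        refine ⟨h2, ?_⟩
        rw [← huW _ h2, ← huW _ hg]
        exact (hue _ (hΩW _ h2) _ (hΩW _ hg)).2
          (.symm hg.1 h2.1 (CrGroup.rel_mul_right hg.1 h1))
      intro h hh h' hh' heq
      obtain ⟨k1, k2⟩ := key h hh
      obtain ⟨k1', k2'⟩ := key h' hh'
      have h3 : S.κ (pF (σ S.y₀), S.Q (C.φ (A.mul (σ S.y₀) (A.mul (A.inv a) h)))) =
        S.κ (pF (σ S.y₀), S.Q (C.φ (A.mul (σ S.y₀) (A.mul (A.inv a) h')))) := by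
        rw [show S.Q _ = S.Q _ from heq]
      nth_rw 1 [← k2, ← k2'] at h3
      rw [hκφ _ k1, hκφ _ k1'] at h3
      have h4 := congrArg C.c h3
      rw [hc _ k1, hc _ k1'] at h4
      have h5 := congrArg (A.mul (A.inv (σ S.y₀))) h4
      have ha' := A.inv_mem haG
      have hhG := A.H_subset hh.1
      have hhG' := A.H_subset hh'.1
      rw [CrGroup.inv_mul_cancel_left hg.1 (A.mul_mem ha' hhG),
        CrGroup.inv_mul_cancel_left hg.1 (A.mul_mem ha' hhG')] at h5
      have h6 := congrArg (A.mul a) h5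
      rwa [CrGroup.mul_inv_cancel_left haG hhG, CrGroup.mul_inv_cancel_left haG hhG'] at h6
  have hud : DF L u := DF.pi fun i => htd.apply _
  refine ⟨S.d, by have := S.d_add_e; omega, ⟨?_⟩⟩
  refine
    { Ω, u, σ
      y₀ := S.y₀
      ε := S.ε
      ε_pos := S.ε_pos
      Ω_subset := fun x hx => hx.1
      definable_Ω := ?_
      exists_isOpen := ?_
      definable_u := hud
      crOn_u := ?_
      u_mem := ?_
      definable_σ := ?_
      contDiffOn_σ := ?_
      σ_mem := ?_
      u_σ := hσ
      u_eq_iff := hue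
      mem_of_rel := ?_ }
  · exact A.definable_G.and (DP.exists (p := fun x h => h ∈ A.H ∧ A.mul x h ∈ W)
      ((A.definable_H.comp DF.snd').and (hWd.comp A.definable_mul)))
  · refine ⟨⋃ h ∈ A.H, O h, isOpen_biUnion hOo, ?_⟩
    ext x
    simp only [Ω, mem_ofPred, mem_inter_iff, mem_iUnion, exists_prop]
    exact and_congr_right fun hx => exists_congr fun h => and_congr_right fun hh => hO h hh x hx
  · refine CrOn.of_locally fun a ha => ?_
    obtain ⟨haG, h, hh, hah⟩ := ha
    refine ⟨O h, hOo h hh, (hO h hh a haG).1 hah, ?_⟩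
    have h1 : CrOn r (fun x => pF (A.mul x h)) (Ω ∩ O h) :=
      (ContDiffOn.crOn (hpF.mono inter_subset_left) hW).comp
        ((CrGroup.crOn_mul_right (A.H_subset hh)).mono fun x hx => hx.1.1)
        fun x hx => (hO h hh x hx.1.1).2 hx.2
    refine h1.congr fun x hx => ?_
    have h2 : A.mul x h ∈ A.G ∩ W :=
      ⟨A.mul_mem hx.1.1 (A.H_subset hh), (hO h hh x hx.1.1).2 hx.2⟩
    dsimp only
    rw [← huW _ h2]
    exact (hue _ hx.1 _ (hΩW _ h2)).2 (CrGroup.rel_mul_right hx.1.1 hh)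
  · intro x hx
    obtain ⟨w, hw, -, hxw⟩ := hΩ x hx
    have : u x = pF w := by
      rw [← huW w hw]
      simp only [u, hxw]
    rw [this]
    exact hw.2.2.1
  · exact C.definable_c.comp (S.definable_κ.comp (DF.id.prodMk (DF.const _)))
  · refine (C.contDiffOn_c.comp S.contDiffOn_κ fun w hw =>
      S.ball_subset (S.κ_mem _ hw.1 _ hw.2)).comp
        (contDiffOn_id.prodMk contDiffOn_const) fun y hy => ⟨hy, hz₀⟩
  · exact fun y hy => hΩW _ (hcκ y hy _ hz₀).1
  · rintro x hx x' hx' hxx'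
    obtain ⟨w, hw, hxw, -⟩ := hΩ x hx
    obtain ⟨h, hh, hhw⟩ := ((hxx'.symm hx.1 hx').trans hx' hx.1 hw.1 hxw).exists_mul hx' hw.1
    exact ⟨hx', h, hh, by rw [hhw]; exact hw.2⟩

end Existence

end Slice

section Quotient

variable {r N d : ℕ} {A : CrGroup L r N} [hL : Fact (ExpandsOrderedField L)]

/-- Bounded definable `C^r` coordinates on cosets: they are locally injective near the slice, and
their zeroth entry vanishes away from it. -/
theorem Slice.exists_bump_map (S : Slice L A d) :
    ∃ (ι : (Fin N → ℝ) → (Fin (d + 1) → ℝ)) (C : Set (Fin d → ℝ)),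
      DF L ι ∧ CrOn r ι A.G ∧ IsOpen C ∧ DP L (· ∈ C) ∧ S.y₀ ∈ C ∧ C ⊆ Metric.ball S.y₀ S.ε ∧
      (∀ x ∈ A.G, ∀ x' ∈ A.G, A.Rel x x' → ι x = ι x') ∧
      (∀ x ∈ S.Ω, S.u x ∈ C → ι x = Fin.cons 1 (S.u x)) ∧
      ∀ x, ι x 0 ≠ 0 → x ∈ S.Ω ∧ (fun j : Fin d => ι x j.succ / ι x 0) = S.u x := by
  classical
  obtain ⟨β, C, K, hβd, hβ, hC, hCd, hyC, hCs, hβC, hK, hKs, hβK⟩ :=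
    exists_bump (L := L) r S.y₀ S.ε_pos
  let Φ : (Fin d → ℝ) → (Fin (d + 1) → ℝ) := fun y => Fin.cons (β y) (fun j => β y * y j)
  have hΦd : DF L Φ := DF.pi fun j => by
    refine Fin.cases ?_ (fun j => ?_) j
    · exact hβd
    · exact hβd.mul (DF.eval _)
  have hΦ : ContDiff ℝ r Φ := contDiff_pi.2 fun j => by
    refine Fin.cases ?_ (fun j => ?_) j
    · exact hβ
    · exact hβ.mul (contDiff_apply _ _ _)
  have hΦ0 : ∀ y ∉ K, Φ y = 0 := fun y hy => funext fun j => by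
    refine Fin.cases ?_ (fun j => ?_) j
    · exact hβK y hy
    · simp [Φ, hβK y hy]
  let T : Set (Fin N → ℝ) := {x | x ∈ S.Ω ∧ S.u x ∈ K}
  have hT : IsClosed T := by
    have h1 : IsCompact ((S.σ '' K) ×ˢ A.H) :=
      (hK.image_of_continuousOn (S.contDiffOn_σ.continuousOn.mono hKs)).prod
        (A.isCompact.of_isClosed_subset S.isClosed_H A.H_subset)
    have h2 : (S.σ '' K) ×ˢ A.H ⊆ A.G ×ˢ A.G := by
      refine prod_mono ?_ A.H_subset
      rintro _ ⟨y, hy, rfl⟩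
      exact S.Ω_subset (S.σ_mem y (hKs hy))
    have h3 := (h1.image_of_continuousOn (A.crOn_mul.continuousOn.mono h2)).isClosed
    suffices h : T = (fun z => A.mul z.1 z.2) '' (S.σ '' K) ×ˢ A.H by rwa [h]
    ext x
    constructor
    · rintro ⟨hx, hxK⟩
      have h4 := S.σ_mem _ (hKs hxK)
      obtain ⟨h, hh, hhx⟩ := ((S.u_eq_iff _ h4 x hx).1 (S.u_σ _ (hKs hxK))).exists_mul
        (S.Ω_subset h4) (S.Ω_subset hx)
      exact ⟨(_, h), ⟨mem_image_of_mem _ hxK, hh⟩, hhx⟩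
    · rintro ⟨⟨_, h⟩, ⟨⟨y, hy, rfl⟩, hh⟩, rfl⟩
      have h4 := S.σ_mem _ (hKs hy)
      have h5 := S.Ω_subset h4
      have h6 := CrGroup.rel_mul_right h5 hh
      have h7 := S.mem_of_rel _ h4 _ (A.mul_mem h5 (A.H_subset hh)) h6
      refine ⟨h7, ?_⟩
      rw [← (S.u_eq_iff _ h4 _ h7).2 h6, S.u_σ y (hKs hy)]
      exact hy
  refine ⟨fun x => if x ∈ S.Ω then Φ (S.u x) else 0, C,
    DF.ite S.definable_Ω (hΦd.comp S.definable_u) (DF.const 0), ?_, hC, hCd, hyC, hCs, ?_, ?_, ?_⟩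
  · refine CrOn.of_locally fun a ha => ?_
    by_cases haΩ : a ∈ S.Ω
    · obtain ⟨W, hW, hΩ⟩ := S.exists_isOpen
      refine ⟨W, hW, (hΩ ▸ haΩ).2, ?_⟩
      rw [← hΩ]
      exact ((ContDiff.crOn univ hΦ).comp S.crOn_u (mapsTo_univ _ _)).congr
        fun x hx => if_pos hx
    · refine ⟨Tᶜ, hT.isOpen_compl, fun h => haΩ h.1, ?_⟩
      refine (ContDiff.crOn _ contDiff_const :
        CrOn r (fun _ : Fin N → ℝ => (0 : Fin (d + 1) → ℝ)) _).congr fun x hx => ?_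
      dsimp only
      split_ifs with h
      · exact hΦ0 _ fun h' => hx.2 ⟨h, h'⟩
      · rfl
  · intro x hx x' hx' h
    by_cases hxΩ : x ∈ S.Ω
    · have h1 := S.mem_of_rel x hxΩ x' hx' h
      simp only [if_pos hxΩ, if_pos h1, (S.u_eq_iff x hxΩ x' h1).2 h]
    · have h1 : x' ∉ S.Ω := fun h1 => hxΩ (S.mem_of_rel x' h1 x hx (h.symm hx hx'))
      simp only [if_neg hxΩ, if_neg h1]
  · intro x hx hxC
    simp only [if_pos hx, Φ, hβC _ hxC, _root_.one_mul]
  · intro x hx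
    by_cases hxΩ : x ∈ S.Ω
    · refine ⟨hxΩ, funext fun j => ?_⟩
      simp only [if_pos hxΩ, Φ, Fin.cons_zero, Fin.cons_succ] at hx ⊢
      exact mul_div_cancel_left₀ _ hx
    · simp [if_neg hxΩ] at hx

variable (L) in
/-- A definable `C^r` map on `G` whose fibres are the left cosets of `H`, and whose image is
locally a graph with definable `C^r` local sections into `G`. -/
structure QuotientMap (A : CrGroup L r N) (k d : ℕ) where
  ι : (Fin N → ℝ) → (Fin k → ℝ)
  definable_ι : DF L ι
  crOn_ι : CrOn r ι A.G
  ι_eq_iff : ∀ x ∈ A.G, ∀ x' ∈ A.G, ι x = ι x' ↔ A.Rel x x'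
  exists_section : ∀ a ∈ A.G, ∃ (τ : Fin d → Fin k) (U : Set (Fin k → ℝ)) (D : Set (Fin d → ℝ))
    (s : (Fin d → ℝ) → (Fin N → ℝ)), Function.Injective τ ∧ ι a ∈ U ∧ IsOpen U ∧ DP L (· ∈ U) ∧
      IsOpen D ∧ DP L (· ∈ D) ∧ DF L s ∧ ContDiffOn ℝ r s D ∧ (∀ y ∈ D, s y ∈ A.G) ∧
      (∀ x ∈ U, coordProj d τ x ∈ D) ∧ (∀ y ∈ D, coordProj d τ (ι (s y)) = y) ∧
      ∀ g ∈ A.G, ι g ∈ U → ι g = ι (s (coordProj d τ (ι g)))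

theorem Slice.exists_quotientMap (S : Slice L A d) : ∃ k, Nonempty (QuotientMap L A k d) := by
  obtain ⟨ι₀, C, hιd, hιr, hC, hCd, hyC, hCs, hrel, hιC, hιne⟩ := S.exists_bump_map
  obtain ⟨W, hW, hΩW⟩ := S.exists_isOpen
  have hcover : ∃ (m : ℕ) (b : Fin m → (Fin N → ℝ)), (∀ i, b i ∈ A.G) ∧
      ∀ x ∈ A.G, ∃ i, A.mul (b i) x ∈ S.Ω ∧ S.u (A.mul (b i) x) ∈ C := by
    have hy₀ := Metric.mem_ball_self (x := S.y₀) S.ε_pos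
    have hσ := S.σ_mem _ hy₀
    let b : (Fin N → ℝ) → (Fin N → ℝ) := fun g => A.mul (S.σ S.y₀) (A.inv g)
    have hb : ∀ g ∈ A.G, b g ∈ A.G := fun g hg => A.mul_mem (S.Ω_subset hσ) (A.inv_mem hg)
    have hbg : ∀ g ∈ A.G, A.mul (b g) g = S.σ S.y₀ := fun g hg => by
      rw [A.mul_assoc _ (S.Ω_subset hσ) _ (A.inv_mem hg) _ hg, A.inv_mul_cancel g hg,
        A.mul_one _ (S.Ω_subset hσ)]
    obtain ⟨t, ht, hcov⟩ := A.isCompact.elim_nhdsWithin_subcover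
      (fun g => {x | A.mul (b g) x ∈ S.Ω ∧ S.u (A.mul (b g) x) ∈ C}) fun g hg => by
        have h1 : ContinuousWithinAt (A.mul (b g)) A.G g :=
          (CrGroup.crOn_mul_left (hb g hg)).continuousOn g hg
        have h2 : ∀ᶠ x in 𝓝[A.G] g, A.mul (b g) x ∈ S.Ω := by
          filter_upwards [h1.eventually (hW.eventually_mem (by
            rw [hbg g hg]; exact (hΩW ▸ hσ).2)), self_mem_nhdsWithin] with x hx hxG
          rw [hΩW]
          exact ⟨A.mul_mem (hb g hg) hxG, hx⟩
        have h3 : Filter.Tendsto (A.mul (b g)) (𝓝[A.G] g) (𝓝[S.Ω] (S.σ S.y₀)) := by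
          rw [← hbg g hg]
          exact tendsto_nhdsWithin_iff.2 ⟨h1, h2⟩
        have h4 : ∀ᶠ x in 𝓝[A.G] g, S.u (A.mul (b g) x) ∈ C := by
          refine ((S.crOn_u.continuousOn _ hσ).tendsto.comp h3).eventually
            (hC.eventually_mem ?_)
          rwa [S.u_σ _ hy₀]
        exact h2.and h4
    refine ⟨t.card, fun i => b (t.equivFin.symm i), fun i => hb _ (ht _ (t.equivFin.symm i).2),
      fun x hx => ?_⟩
    obtain ⟨g, hg, hgx⟩ := mem_iUnion₂.1 (hcov hx)
    refine ⟨t.equivFin ⟨g, hg⟩, ?_⟩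
    simpa only [Equiv.symm_apply_apply, mem_ofPred] using hgx
  obtain ⟨m, b, hb, hbC⟩ := hcover
  let ι : (Fin N → ℝ) → (Fin (m * (d + 1)) → ℝ) := fun x l =>
    ι₀ (A.mul (b (finProdFinEquiv.symm l).1) x) (finProdFinEquiv.symm l).2
  have hι : ∀ x i j, ι x (finProdFinEquiv (i, j)) = ι₀ (A.mul (b i) x) j := fun x i j => by
    simp only [ι, Equiv.symm_apply_apply]
  have hιrel : ∀ x ∈ A.G, ∀ x' ∈ A.G, A.Rel x x' → ι x = ι x' := by
    intro x hx x' hx' h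
    funext l
    simp only [ι]
    rw [hrel _ (A.mul_mem (hb _) hx) _ (A.mul_mem (hb _) hx')
      ((CrGroup.rel_mul_left (hb _) hx hx').2 h)]
  refine ⟨m * (d + 1), ⟨{ ι
                          definable_ι := ?_
                          crOn_ι := ?_
                          ι_eq_iff := ?_
                          exists_section := ?_ }⟩⟩
  · exact DF.pi fun l => (hιd.comp (CrGroup.DF_mul (DF.const _) DF.id)).apply _
  · refine CrOn.pi fun l => ?_
    exact ((hιr.comp (CrGroup.crOn_mul_left (hb _)) fun x hx => A.mul_mem (hb _) hx).clm_comp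
      (ContinuousLinearMap.proj (R := ℝ) (φ := fun _ : Fin (d + 1) => ℝ) _))
  · refine fun x hx x' hx' => ⟨fun h => ?_, hιrel x hx x' hx'⟩
    obtain ⟨i, hi, hiC⟩ := hbC x hx
    have h1 : ι₀ (A.mul (b i) x') = Fin.cons 1 (S.u (A.mul (b i) x)) := by
      rw [← hιC _ hi hiC]
      funext j
      rw [← hι, ← hι, h]
    obtain ⟨h2, h3⟩ := hιne (A.mul (b i) x') (by rw [h1, Fin.cons_zero]; exact one_ne_zero)
    simp only [h1, Fin.cons_zero, Fin.cons_succ, div_one] at h3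
    exact (CrGroup.rel_mul_left (hb i) hx hx').1 ((S.u_eq_iff _ hi _ h2).1 h3)
  · intro a ha
    obtain ⟨i, hi, hiC⟩ := hbC a ha
    have hbi := A.inv_mem (hb i)
    let l₀ := finProdFinEquiv (i, (0 : Fin (d + 1)))
    let τ : Fin d → Fin (m * (d + 1)) := fun j => finProdFinEquiv (i, j.succ)
    let s : (Fin d → ℝ) → (Fin N → ℝ) := fun y => A.mul (A.inv (b i)) (S.σ y)
    have hτc : Continuous (coordProj d τ) := continuous_pi fun j => continuous_apply _
    have hτd : DF L (coordProj d τ) := DF.pi fun j => DF.eval _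
    have hσG : ∀ y ∈ C, S.σ y ∈ A.G := fun y hy => S.Ω_subset (S.σ_mem y (hCs hy))
    have hsG : ∀ y ∈ C, s y ∈ A.G := fun y hy => A.mul_mem hbi (hσG y hy)
    have hbs : ∀ y ∈ C, A.mul (b i) (s y) = S.σ y := fun y hy =>
      CrGroup.mul_inv_cancel_left (hb i) (hσG y hy)
    have hιi : ∀ x, A.mul (b i) x ∈ S.Ω → S.u (A.mul (b i) x) ∈ C →
        ι x l₀ = 1 ∧ coordProj d τ (ι x) = S.u (A.mul (b i) x) := by
      intro x hx hxC
      refine ⟨?_, funext fun j => ?_⟩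
      · simp only [l₀, hι, hιC _ hx hxC, Fin.cons_zero]
      · simp only [coordProj, τ, hι, hιC _ hx hxC, Fin.cons_succ]
    refine ⟨τ, {x | 0 < x l₀} ∩ (fun x j => x (τ j) / x l₀) ⁻¹' C ∩ coordProj d τ ⁻¹' C, C, s,
      ?_, ?_, ?_, ?_, hC, hCd, ?_, ?_, hsG, fun x hx => hx.2, ?_, ?_⟩
    · intro j j' h
      simpa [τ] using h
    · obtain ⟨h1, h2⟩ := hιi a hi hiC
      refine ⟨⟨by simp [h1], ?_⟩, by rwa [mem_preimage, h2]⟩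
      simp only [mem_preimage, h1, div_one]
      rwa [← h2] at hiC
    · refine IsOpen.inter (ContinuousOn.isOpen_inter_preimage ?_
        (isOpen_lt continuous_const (continuous_apply _)) hC) (hC.preimage hτc)
      refine continuousOn_pi.2 fun j => ?_
      exact (continuous_apply _).continuousOn.div (continuous_apply _).continuousOn
        fun x hx => ne_of_gt hx
    · exact ((DP.lt (DF.const 0) (DF.eval _)).and
        (hCd.comp (DF.pi fun j => (DF.eval _).div (DF.eval _)))).and (hCd.comp hτd)
    · exact CrGroup.DF_mul (DF.const _) S.definable_σ
    · exact ((CrGroup.crOn_mul_left hbi).comp (ContDiffOn.crOn (S.contDiffOn_σ.mono hCs) hC)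
        hσG).contDiffOn
    · intro y hy
      have h1 := S.u_σ y (hCs hy)
      rw [(hιi (s y) (by rw [hbs y hy]; exact S.σ_mem y (hCs hy))
        (by rwa [hbs y hy, h1])).2, hbs y hy, h1]
    · rintro g hg ⟨⟨h0, hq⟩, hC'⟩
      have h1 : ι g l₀ = ι₀ (A.mul (b i) g) 0 := hι _ _ _
      obtain ⟨h2, h3⟩ := hιne (A.mul (b i) g) (by rw [← h1]; exact ne_of_gt h0)
      have h4 : (fun j => ι g (τ j) / ι g l₀) = S.u (A.mul (b i) g) := by
        rw [← h3]
        simp only [τ, l₀, hι]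
      rw [mem_preimage, h4] at hq
      rw [(hιi g h2 hq).2]
      refine hιrel g hg _ (hsG _ hq) ((CrGroup.rel_mul_left (hb i) hg (hsG _ hq)).1 ?_)
      rw [hbs _ hq]
      exact (S.u_eq_iff _ h2 _ (S.σ_mem _ (hCs hq))).1 (S.u_σ _ (hCs hq)).symm

end Quotient

namespace QuotientMap

variable {r N k d : ℕ} {A : CrGroup L r N} (q : QuotientMap L A k d)

theorem definable_image : DP L (· ∈ q.ι '' A.G) :=
  DP.exists (p := fun x g => g ∈ A.G ∧ q.ι g = x)
    ((A.definable_G.comp DF.snd').and (DP.eq (q.definable_ι.comp DF.snd') DF.fst'))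

theorem isCompact_image : IsCompact (q.ι '' A.G) :=
  A.isCompact.image_of_continuousOn q.crOn_ι.continuousOn

theorem isClosed_of_isClosed_preimage {K : Set (Fin k → ℝ)} (hK : K ⊆ q.ι '' A.G)
    (h : IsClosed (A.G ∩ q.ι ⁻¹' K)) : IsClosed K := by
  have h1 : q.ι '' (A.G ∩ q.ι ⁻¹' K) = K := by
    rw [image_inter_preimage, inter_eq_right.2 hK]
  rw [← h1]
  exact ((A.isCompact.of_isClosed_subset h inter_subset_left).image_of_continuousOn
    (q.crOn_ι.continuousOn.mono inter_subset_left)).isClosed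

theorem exists_local_section {a : Fin k → ℝ} (ha : a ∈ q.ι '' A.G) :
    ∃ (U : Set (Fin k → ℝ)) (s : (Fin k → ℝ) → (Fin N → ℝ)), a ∈ U ∧ IsOpen U ∧
      CrOn r s U ∧ (∀ x ∈ U, s x ∈ A.G) ∧ ∀ x ∈ q.ι '' A.G ∩ U, q.ι (s x) = x := by
  obtain ⟨g, hg, rfl⟩ := ha
  obtain ⟨τ, U, D, s, -, haU, hU, -, hD, -, -, hs, hsG, hUD, -, hX⟩ := q.exists_section g hg
  refine ⟨U, fun x => s (coordProj d τ x), haU, hU, ?_, fun x hx => hsG _ (hUD x hx), ?_⟩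
  · have h1 : ContDiff ℝ r (coordProj d τ) := contDiff_pi.2 fun j => contDiff_apply _ _ _
    exact (ContDiffOn.crOn hs hD).comp (ContDiff.crOn U h1) hUD
  · rintro _ ⟨⟨g', hg', rfl⟩, hU'⟩
    exact (hX g' hg' hU').symm

variable [hL : Fact (ExpandsOrderedField L)]

theorem isDefCrSubmanifold_image : IsDefCrSubmanifold L r k d (q.ι '' A.G) := by
  refine isDefCrSubmanifold_of_graph q.definable_image ?_
  rintro _ ⟨g, hg, rfl⟩
  obtain ⟨τ, U, D, s, hτ, haU, hU, hUd, hD, hDd, hsd, hs, hsG, hUD, hsτ, hX⟩ :=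
    q.exists_section g hg
  refine ⟨τ, U, D, fun y => q.ι (s y), hτ, haU, hU, hUd, hD, hDd, q.definable_ι.comp hsd,
    (q.crOn_ι.comp (ContDiffOn.crOn hs hD) hsG).contDiffOn, hUD, hsτ, fun x hx => ?_⟩
  constructor
  · rintro ⟨g', hg', rfl⟩
    exact hX g' hg' hx
  · intro h
    rw [h]
    exact ⟨_, hsG _ (hUD x hx), rfl⟩

variable [hO : Fact (LocallyOMinimal L)]

theorem hasDim_image : HasDim (q.ι '' A.G) d := by
  constructor
  · have h1 := A.H_subset A.one_mem
    obtain ⟨τ, U, D, s, hτ, haU, -, -, hD, -, -, -, hsG, hUD, hsτ, -⟩ := q.exists_section _ h1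
    refine ⟨τ, hτ, _, mem_interior.2 ⟨D, fun y hy => ?_, hD, hUD _ haU⟩⟩
    exact ⟨_, ⟨_, hsG y hy, rfl⟩, hsτ y hy⟩
  · intro e σ _ hσ
    refine le_of_locally_injOn q.definable_image q.isCompact_image.isBounded ?_ σ hσ
    rintro _ ⟨g, hg, rfl⟩
    obtain ⟨τ, U, D, s, -, haU, hU, -, -, -, -, -, -, -, -, hX⟩ := q.exists_section g hg
    refine ⟨U, hU.mem_nhds haU, coordProj d τ, DF.pi fun j => DF.eval _, ?_⟩
    rintro _ ⟨⟨g₁, hg₁, rfl⟩, h₁⟩ _ ⟨⟨g₂, hg₂, rfl⟩, h₂⟩ h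
    rw [hX g₁ hg₁ h₁, hX g₂ hg₂ h₂, h]

theorem exists_global_section : ∃ s : (Fin k → ℝ) → (Fin N → ℝ), DF L s ∧
    ∀ x ∈ q.ι '' A.G, s x ∈ A.G ∧ q.ι (s x) = x := by
  obtain ⟨M, hM⟩ := A.isCompact.isBounded.exists_norm_le
  obtain ⟨s, hs, hs', -⟩ := exists_choice (L := L) (E := Fin k → ℝ)
    (R := fun x g => g ∈ A.G ∧ q.ι g = x)
    ((A.definable_G.comp DF.snd').and (DP.eq (q.definable_ι.comp DF.snd') DF.fst'))
    (fun _ => ⟨M, fun g hg i => (norm_le_pi_norm g i).trans (hM g hg.1)⟩)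
  exact ⟨s, hs, fun x hx => hs' x hx⟩

theorem exists_group_operations
    (hn : ∀ g ∈ A.G, ∀ h ∈ A.H, A.mul (A.mul g h) (A.inv g) ∈ A.H) :
    ∃ (multX : (Fin (k + k) → ℝ) → (Fin k → ℝ)) (invX : (Fin k → ℝ) → (Fin k → ℝ)),
      DF L multX ∧ CrOn r multX {z | fstFun z ∈ q.ι '' A.G ∧ sndFun z ∈ q.ι '' A.G} ∧
      DF L invX ∧ CrOn r invX (q.ι '' A.G) ∧
      (∀ g₁ ∈ A.G, ∀ g₂ ∈ A.G, multX (Fin.append (q.ι g₁) (q.ι g₂)) = q.ι (A.mul g₁ g₂)) ∧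
      ∀ g ∈ A.G, invX (q.ι g) = q.ι (A.inv g) := by
  obtain ⟨s, hsd, hs⟩ := q.exists_global_section
  let multX : (Fin (k + k) → ℝ) → (Fin k → ℝ) := fun z =>
    q.ι (A.mul (s (fstFun z)) (s (sndFun z)))
  let invX : (Fin k → ℝ) → (Fin k → ℝ) := fun x => q.ι (A.inv (s x))
  have hmul : ∀ z : Fin (k + k) → ℝ, ∀ g₁ ∈ A.G, ∀ g₂ ∈ A.G, q.ι g₁ = fstFun z →
      q.ι g₂ = sndFun z → multX z = q.ι (A.mul g₁ g₂) := by
    intro z g₁ hg₁ g₂ hg₂ h₁ h₂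
    obtain ⟨h3, h4⟩ := hs (fstFun z) ⟨g₁, hg₁, h₁⟩
    obtain ⟨h5, h6⟩ := hs (sndFun z) ⟨g₂, hg₂, h₂⟩
    have h7 := (q.ι_eq_iff _ h3 _ hg₁).1 (h4.trans h₁.symm)
    have h8 := (q.ι_eq_iff _ h5 _ hg₂).1 (h6.trans h₂.symm)
    exact (q.ι_eq_iff _ (A.mul_mem h3 h5) _ (A.mul_mem hg₁ hg₂)).2
      (h7.mul_mul hn h3 hg₁ h5 hg₂ h8)
  have hinv : ∀ x, ∀ g ∈ A.G, q.ι g = x → invX x = q.ι (A.inv g) := by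
    rintro _ g hg rfl
    obtain ⟨h3, h4⟩ := hs (q.ι g) ⟨g, hg, rfl⟩
    rw [q.ι_eq_iff _ h3 _ hg] at h4
    exact (q.ι_eq_iff _ (A.inv_mem h3) _ (A.inv_mem hg)).2 (h4.inv_inv hn h3 hg)
  have hfst : ContDiff ℝ r (fstFun (m := k) (n := k)) :=
    contDiff_pi.2 fun j => contDiff_apply _ _ _
  have hsnd : ContDiff ℝ r (sndFun (m := k) (n := k)) :=
    contDiff_pi.2 fun j => contDiff_apply _ _ _
  refine ⟨multX, invX,
    q.definable_ι.comp (CrGroup.DF_mul (hsd.comp DF.fstFun) (hsd.comp DF.sndFun)), ?_,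
    q.definable_ι.comp (CrGroup.DF_inv hsd), ?_, fun g₁ hg₁ g₂ hg₂ =>
      hmul _ g₁ hg₁ g₂ hg₂ (fstFun_append _ _).symm (sndFun_append _ _).symm,
    fun g hg => hinv _ g hg rfl⟩
  · refine CrOn.of_locally fun z hz => ?_
    obtain ⟨U₁, s₁, hz₁, hU₁, hs₁, hG₁, hι₁⟩ := q.exists_local_section hz.1
    obtain ⟨U₂, s₂, hz₂, hU₂, hs₂, hG₂, hι₂⟩ := q.exists_local_section hz.2
    refine ⟨fstFun ⁻¹' U₁ ∩ sndFun ⁻¹' U₂,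
      (hU₁.preimage hfst.continuous).inter (hU₂.preimage hsnd.continuous), ⟨hz₁, hz₂⟩, ?_⟩
    have h1 : CrOn r (fun z : Fin (k + k) → ℝ => (s₁ (fstFun z), s₂ (sndFun z)))
        (fstFun ⁻¹' U₁ ∩ sndFun ⁻¹' U₂) :=
      (hs₁.comp (ContDiff.crOn _ hfst) fun z hz => hz.1).prodMk
        (hs₂.comp (ContDiff.crOn _ hsnd) fun z hz => hz.2)
    have h2 := (q.crOn_ι.comp A.crOn_mul fun z hz => A.mul_mem hz.1 hz.2).comp h1
      fun z hz => ⟨hG₁ _ hz.1, hG₂ _ hz.2⟩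
    refine (h2.mono inter_subset_right).congr fun z hz => ?_
    exact hmul z _ (hG₁ _ hz.2.1) _ (hG₂ _ hz.2.2) (hι₁ _ ⟨hz.1.1, hz.2.1⟩)
      (hι₂ _ ⟨hz.1.2, hz.2.2⟩)
  · refine CrOn.of_locally fun x hx => ?_
    obtain ⟨U, s', hxU, hU, hs', hG, hι⟩ := q.exists_local_section hx
    refine ⟨U, hU, hxU, ?_⟩
    have h2 := (q.crOn_ι.comp A.crOn_inv fun z hz => A.inv_mem hz).comp hs' hG
    exact (h2.mono inter_subset_right).congr fun x hx => hinv x _ (hG x hx.2) (hι x hx)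

end QuotientMap

end Tools

/-- existence of the definable `C^r` quotient of a closed bounded definable
`C^r` group by a definable subgroup, together with the induced group operations when the
subgroup is normal. -/
theorem statement7
    (hfield : ExpandsOrderedField L) (hlom : LocallyOMinimal L)
    (r N dG dH : ℕ)
    (G : Set (Fin N → ℝ)) (hG : IsDefCrSubmanifold L r N dG G)
    (hGdim : HasDim G dG) (hGclosed : IsClosed G) (hGbdd : Bornology.IsBounded G)
    (mul : (Fin N → ℝ) → (Fin N → ℝ) → (Fin N → ℝ))
    (inv : (Fin N → ℝ) → (Fin N → ℝ)) (e : Fin N → ℝ)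
    (he : e ∈ G)
    (hmul_mem : ∀ x ∈ G, ∀ y ∈ G, mul x y ∈ G)
    (hinv_mem : ∀ x ∈ G, inv x ∈ G)
    (hassoc : ∀ x ∈ G, ∀ y ∈ G, ∀ z ∈ G, mul (mul x y) z = mul x (mul y z))
    (hident : ∀ x ∈ G, mul e x = x ∧ mul x e = x)
    (hinverse : ∀ x ∈ G, mul x (inv x) = e ∧ mul (inv x) x = e)
    (hmul_cr : DefCrMapOn L r (N + N) N {z | fstFun z ∈ G ∧ sndFun z ∈ G}
      (fun z => mul (fstFun z) (sndFun z)))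
    (hinv_cr : DefCrMapOn L r N N G inv)
    (H : Set (Fin N → ℝ)) (hHdef : Def L N H) (hHG : H ⊆ G) (hHdim : HasDim H dH)
    (heH : e ∈ H)
    (hHmul : ∀ x ∈ H, ∀ y ∈ H, mul x y ∈ H)
    (hHinv : ∀ x ∈ H, inv x ∈ H) :
    ∃ (k dX : ℕ) (X : Set (Fin k → ℝ)) (ι : (Fin N → ℝ) → (Fin k → ℝ)),
      IsDefCrSubmanifold L r k dX X ∧ HasDim X dX ∧ dX + dH = dG ∧
      DefCrMapOn L r N k G ι ∧ ι '' G = X ∧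
      (∀ g₁ ∈ G, ∀ g₂ ∈ G, (ι g₁ = ι g₂ ↔ mul (inv g₁) g₂ ∈ H)) ∧
      (∀ K : Set (Fin k → ℝ), K ⊆ X → Def L k K →
        IsClosed (G ∩ ι ⁻¹' K) → ∃ C, IsClosed C ∧ K = X ∩ C) ∧
      ((∀ g ∈ G, ∀ h ∈ H, mul (mul g h) (inv g) ∈ H) →
        ∃ (multX : (Fin (k + k) → ℝ) → (Fin k → ℝ))
          (invX : (Fin k → ℝ) → (Fin k → ℝ)),
          DefCrMapOn L r (k + k) k {z | fstFun z ∈ X ∧ sndFun z ∈ X} multX ∧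
          DefCrMapOn L r k k X invX ∧
          (∀ x, fstFun (m := k) (n := k) x ∈ X → sndFun (m := k) (n := k) x ∈ X →
            multX x ∈ X) ∧
          (∀ x ∈ X, invX x ∈ X) ∧
          (∀ g₁ ∈ G, ∀ g₂ ∈ G, multX (Fin.append (ι g₁) (ι g₂)) = ι (mul g₁ g₂)) ∧
          (∀ g ∈ G, invX (ι g) = ι (inv g))) := by
  have : Fact (ExpandsOrderedField L) := ⟨hfield⟩
  have : Fact (LocallyOMinimal L) := ⟨hlom⟩
  have hGd : DP L (· ∈ G) := hG.1
  have hGG : DP L fun z : Fin (N + N) → ℝ => z ∈ {z | fstFun z ∈ G ∧ sndFun z ∈ G} :=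
    (hGd.comp DF.fstFun).and (hGd.comp DF.sndFun)
  obtain ⟨mul₁, hmul₁, hmul⟩ := hmul_cr.1.exists_DF hGG
  obtain ⟨inv', hinv', hinv⟩ := hinv_cr.1.exists_DF hGd
  let mul' : (Fin N → ℝ) → (Fin N → ℝ) → (Fin N → ℝ) := fun x y => mul₁ (Fin.append x y)
  have hmul' : ∀ x ∈ G, ∀ y ∈ G, mul' x y = mul x y := fun x hx y hy => by
    have h1 : Fin.append x y ∈ {z : Fin (N + N) → ℝ | fstFun z ∈ G ∧ sndFun z ∈ G} := by
      simpa only [mem_ofPred, fstFun_append, sndFun_append] using ⟨hx, hy⟩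
    have := hmul h1
    simpa only [fstFun_append, sndFun_append] using this
  have happ : ContDiff ℝ r fun z : (Fin N → ℝ) × (Fin N → ℝ) => Fin.append z.1 z.2 :=
    contDiff_pi.2 fun i => by
      induction i using Fin.addCases with
      | left i =>
        simp only [Fin.append_left]
        fun_prop
      | right i =>
        simp only [Fin.append_right]
        fun_prop
  have hmulr : CrOn r (fun z : (Fin N → ℝ) × (Fin N → ℝ) => mul' z.1 z.2) (G ×ˢ G) := by
    have h1 : CrOn r (fun z => mul (fstFun z) (sndFun z))
      {z : Fin (N + N) → ℝ | fstFun z ∈ G ∧ sndFun z ∈ G} := hmul_cr.2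
    refine (h1.comp (ContDiff.crOn _ happ) fun z hz => ?_).congr fun z hz => ?_
    · simpa only [mem_ofPred, fstFun_append, sndFun_append, mem_prod] using hz
    · simpa only [fstFun_append, sndFun_append] using hmul' z.1 hz.1 z.2 hz.2
  have hinvr : CrOn r inv G := hinv_cr.2
  let A : CrGroup L r N :=
    { G, H
      mul := mul'
      inv := inv'
      one := e
      isCompact := Metric.isCompact_of_isClosed_isBounded hGclosed hGbdd
      definable_G := hGd
      definable_H := hHdef
      definable_mul := hmul₁.comp (DF.append DF.fst' DF.snd')
      definable_inv := hinv'
      crOn_mul := hmulr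
      crOn_inv := hinvr.congr hinv
      one_mem := heH
      mul_mem := fun {x y} hx hy => by
        rw [hmul' x hx y hy]
        exact hmul_mem x hx y hy
      inv_mem := fun {x} hx => by
        rw [hinv hx]
        exact hinv_mem x hx
      mul_assoc := fun x hx y hy z hz => by
        rw [hmul' x hx y hy, hmul' y hy z hz, hmul' _ (hmul_mem x hx y hy) z hz,
          hmul' x hx _ (hmul_mem y hy z hz)]
        exact hassoc x hx y hy z hz
      one_mul := fun x hx => by
        rw [hmul' e he x hx]
        exact (hident x hx).1
      mul_one := fun x hx => by
        rw [hmul' x hx e he]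
        exact (hident x hx).2
      inv_mul_cancel := fun x hx => by
        rw [hinv hx, hmul' _ (hinv_mem x hx) x hx]
        exact (hinverse x hx).2
      H_subset := hHG
      H_mul_mem := fun {x y} hx hy => by
        rw [hmul' x (hHG hx) y (hHG hy)]
        exact hHmul x hx y hy
      H_inv_mem := fun {x} hx => by
        rw [hinv (hHG hx)]
        exact hHinv x hx }
  have hdN : dG ≤ N := by
    obtain ⟨σ, hσ, -⟩ := hGdim.1
    simpa using Fintype.card_le_of_injective σ hσ
  obtain ⟨C⟩ := IsDefCrSubmanifold.exists_chart hG hdN ⟨e, he⟩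
  obtain ⟨d, hd, ⟨S⟩⟩ := A.exists_slice C hHdim
  obtain ⟨k, ⟨q⟩⟩ := S.exists_quotientMap
  have hXd := q.definable_image
  refine ⟨k, d, q.ι '' G, q.ι, q.isDefCrSubmanifold_image, q.hasDim_image, hd,
    ⟨DefMapOn.of_DF hGd q.definable_ι, q.crOn_ι⟩, rfl, ?_, ?_, ?_⟩
  · intro g₁ hg₁ g₂ hg₂
    have h1 : q.ι g₁ = q.ι g₂ ↔ mul' (inv' g₁) g₂ ∈ H := q.ι_eq_iff g₁ hg₁ g₂ hg₂
    rwa [hinv hg₁, hmul' _ (hinv_mem g₁ hg₁) g₂ hg₂] at h1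
  · intro K hK _ hKc
    exact ⟨K, q.isClosed_of_isClosed_preimage hK hKc, (inter_eq_right.2 hK).symm⟩
  · intro hn
    obtain ⟨multX, invX, hm1, hm2, hi1, hi2, hm, hi⟩ := q.exists_group_operations
      fun g hg h hh => by
        change mul' (mul' g h) (inv' g) ∈ H
        have h1 := hmul_mem g hg h (hHG hh)
        rw [hmul' g hg h (hHG hh), hinv hg, hmul' _ h1 _ (hinv_mem g hg)]
        exact hn g hg h hh
    have hm' : ∀ g₁ ∈ G, ∀ g₂ ∈ G, multX (Fin.append (q.ι g₁) (q.ι g₂)) = q.ι (mul g₁ g₂) :=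
      fun g₁ hg₁ g₂ hg₂ => by
        rw [← hmul' g₁ hg₁ g₂ hg₂]
        exact hm g₁ hg₁ g₂ hg₂
    have hi' : ∀ g ∈ G, invX (q.ι g) = q.ι (inv g) := fun g hg => by
      rw [← hinv hg]
      exact hi g hg
    refine ⟨multX, invX, ⟨DefMapOn.of_DF ((hXd.comp DF.fstFun).and (hXd.comp DF.sndFun)) hm1, hm2⟩,
      ⟨DefMapOn.of_DF hXd hi1, hi2⟩, ?_, ?_, hm', hi'⟩
    · rintro z ⟨g₁, hg₁, h₁⟩ ⟨g₂, hg₂, h₂⟩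
      rw [← append_fstFun_sndFun z, ← h₁, ← h₂, hm' g₁ hg₁ g₂ hg₂]
      exact mem_image_of_mem _ (hmul_mem g₁ hg₁ g₂ hg₂)
    · rintro _ ⟨g, hg, rfl⟩
      rw [hi' g hg]
      exact mem_image_of_mem _ (hinv_mem g hg)

end Paper
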